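/- Let ε ∈ {−2, 2} and let A, K be positive integers. Put a = K, b = A²K + 2εA, c = (A+1)²K + 2ε(A+1). Suppose {a, b, c, d} is a D(4)-quadruple with d > 2 such that 4d ≠ (2A² + 2A)²K³ + ε(16A³ + 24A² + 8A)K² + (80A² + 80A + 16)K + ε(32A + 16). Then for each pair (A₀, K₀) in {(1326, 0), (454, 1000), (3, 23000), (2, 210000)}: if A ≥ A₀, then K < 240.24·(A+1) + K₀. -/

import Mathlib

/-- `a, b, c, d` form a `D(4)`-quadruple: four distinct positive integers such that
the product of any two distinct elements increased by `4` is a perfect square. -/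
def IsDiophQuadruple (n a b c d : ℤ) : Prop :=
  0 < a ∧ 0 < b ∧ 0 < c ∧ 0 < d ∧
  a ≠ b ∧ a ≠ c ∧ a ≠ d ∧ b ≠ c ∧ b ≠ d ∧ c ≠ d ∧
  IsSquare (a * b + n) ∧ IsSquare (a * c + n) ∧ IsSquare (a * d + n) ∧
  IsSquare (b * c + n) ∧ IsSquare (b * d + n) ∧ IsSquare (c * d + n)

theorem Ring.succ_mul_choose_succ (r : ℝ) (n : ℕ) :
    ((n : ℝ) + 1) * Ring.choose r (n + 1) = (r - n) * Ring.choose r n := by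
  rw [Ring.choose_eq_smul, Ring.choose_eq_smul, descPochhammer_succ_right, Nat.factorial_succ]
  have h : (n.factorial : ℝ) ≠ 0 := by positivity
  simp [Polynomial.smeval_mul, Polynomial.smeval_natCast]
  field_simp

theorem Ring.succ_mul_choose_succ_succ (r : ℝ) (n : ℕ) :
    ((n : ℝ) + 1) * Ring.choose (r + 1) (n + 1) = (r + 1) * Ring.choose r n := by
  have h := Ring.choose_succ_succ r n
  have h' := Ring.succ_mul_choose_succ r n
  rw [h, mul_add, h']
  ring

theorem four_pow_mul_choose_neg_half (m : ℕ) :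
    (4 : ℝ) ^ m * Ring.choose (-1 / 2 : ℝ) m = (-1) ^ m * (m.centralBinom : ℝ) := by
  induction m with
  | zero => simp
  | succ m ih =>
    have h1 := Ring.succ_mul_choose_succ (-1 / 2) m
    have h2 : ((m : ℝ) + 1) * ((m + 1).centralBinom : ℝ) = 2 * (2 * m + 1) * m.centralBinom := by
      exact_mod_cast Nat.succ_mul_centralBinom_succ m
    have h3 : ((m : ℝ) + 1) ≠ 0 := by positivity
    apply mul_left_cancel₀ h3
    linear_combination (4 : ℝ) ^ (m + 1) * h1 - (-1) ^ (m + 1) * h2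
      - 2 * (2 * (m : ℝ) + 1) * ih

theorem four_pow_mul_choose_half_mem (k m : ℕ) :
    (4 : ℝ) ^ m * Ring.choose ((k : ℝ) + 1 / 2) m ∈ (Int.castRingHom ℝ).range := by
  have h : (k : ℝ) + 1 / 2 = (-1 / 2 : ℝ) + ((k + 1 : ℕ) : ℝ) := by push_cast; ring
  rw [h, Ring.add_choose_eq m (Commute.all _ _), Finset.mul_sum]
  refine Subring.sum_mem _ fun ij hij => ?_
  have hm := Finset.HasAntidiagonal.mem_antidiagonal.1 hij
  rw [Ring.choose_natCast, ← hm, pow_add]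
  refine ⟨(-1) ^ ij.1 * ij.1.centralBinom * (4 ^ ij.2 * (k + 1).choose ij.2), ?_⟩
  have := four_pow_mul_choose_neg_half ij.1
  rw [eq_intCast]
  push_cast
  rw [← this]
  ring

theorem abs_choose_half_le_one (m : ℕ) : |Ring.choose (1 / 2 : ℝ) m| ≤ 1 := by
  induction m with
  | zero => simp
  | succ m ih =>
    have h1 := Ring.succ_mul_choose_succ (1 / 2) m
    have h3 : (0 : ℝ) < (m : ℝ) + 1 := by positivity
    have h2 := congrArg abs h1
    rw [abs_mul, abs_mul, abs_of_pos h3] at h2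
    have h4 : |(1 / 2 : ℝ) - m| ≤ m + 1 := by
      rw [abs_le]; constructor <;> linarith [(Nat.cast_nonneg m : (0 : ℝ) ≤ m)]
    have h5 : ((m : ℝ) + 1) * |Ring.choose (1 / 2 : ℝ) (m + 1)| ≤ ((m : ℝ) + 1) * 1 := by
      rw [h2]; exact mul_le_mul h4 ih (abs_nonneg _) h3.le
    exact le_of_mul_le_mul_left h5 h3

theorem six_pow_mul_abs_choose_le_one (k : ℕ) :
    (6 : ℝ) ^ k * |Ring.choose ((k : ℝ) + 1 / 2) (3 * k)| ≤ 1 := by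
  induction k with
  | zero => simp
  | succ k ih =>
    set κ : ℝ := (k : ℝ) + 1 / 2 with hκ
    have h1 := Ring.succ_mul_choose_succ κ (3 * k)
    have h2 := Ring.succ_mul_choose_succ κ (3 * k + 1)
    have h3 := Ring.succ_mul_choose_succ_succ κ (3 * k + 2)
    have e : ((k + 1 : ℕ) : ℝ) + 1 / 2 = κ + 1 := by rw [hκ]; push_cast; ring
    rw [e, show 3 * (k + 1) = 3 * k + 2 + 1 by ring]
    push_cast at h1 h2 h3
    set x := Ring.choose κ (3 * k)
    set y := Ring.choose κ (3 * k + 1)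
    set z := Ring.choose κ (3 * k + 2)
    set w := Ring.choose (κ + 1) (3 * k + 2 + 1)
    have hk : (0 : ℝ) ≤ k := Nat.cast_nonneg k
    set P : ℝ := (3 * k + 1) * (3 * k + 2) * (3 * k + 3) with hP
    have hP0 : 0 < P := by positivity
    have key : P * w = (κ + 1) * (κ - 3 * k - 1) * (κ - 3 * k) * x := by
      rw [hP]
      linear_combination (3 * (k : ℝ) + 1) * (3 * k + 2) * h3
        + (κ + 1) * (3 * (k : ℝ) + 1) * h2 + (κ + 1) * (κ - 3 * k - 1) * h1
    have key2 := congrArg abs key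
    rw [abs_mul P, abs_mul _ x, abs_of_pos hP0] at key2
    have hb : 6 * |(κ + 1) * (κ - 3 * k - 1) * (κ - 3 * k)| ≤ P := by
      rw [← abs_of_pos (show (0 : ℝ) < 6 by norm_num), ← abs_mul, abs_le, hP, hκ]
      constructor <;> nlinarith [mul_nonneg hk hk, mul_nonneg (mul_nonneg hk hk) hk]
    have : P * (6 ^ (k + 1) * |w|) ≤ P * 1 := by
      calc P * (6 ^ (k + 1) * |w|) = 6 ^ (k + 1) * (P * |w|) := by ring
        _ = (6 * |(κ + 1) * (κ - 3 * k - 1) * (κ - 3 * k)|) * (6 ^ k * |x|) := by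
            rw [key2]; ring
        _ ≤ P * 1 := mul_le_mul hb ih (by positivity) hP0.le
    exact le_of_mul_le_mul_left this hP0

theorem hasSum_choose_mul_coeff {κ y a : ℝ} (h : |a * y| < 1) (m : ℕ) :
    HasSum (fun n : ℕ => Ring.choose κ n * y ^ n * ((n.choose m : ℝ) * a ^ (n - m)))
      (Ring.choose κ m * y ^ m * (1 + a * y) ^ (κ - m)) := by
  have hs : HasSum (fun j : ℕ => Ring.choose (κ - m) j * (a * y) ^ j) ((1 + a * y) ^ (κ - m)) := by
    have := (Real.one_add_rpow_hasFPowerSeriesOnBall_zero (a := κ - m)).hasSum (y := a * y) (by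
      rw [← ENNReal.ofReal_one, Metric.eball_ofReal]; simpa using h)
    simpa [binomialSeries, FormalMultilinearSeries.coeff_ofScalars, mul_comm] using this
  rw [← hasSum_nat_add_iff' m]
  have h0 : ∑ i ∈ Finset.range m,
      Ring.choose κ i * y ^ i * ((i.choose m : ℝ) * a ^ (i - m)) = 0 :=
    Finset.sum_eq_zero fun i hi => by
      rw [Nat.choose_eq_zero_of_lt (Finset.mem_range.1 hi)]; simp
  rw [h0, sub_zero]
  refine (hs.mul_left (Ring.choose κ m * y ^ m)).congr_fun ?_
  intro j
  have := Ring.choose_add_smul_choose (κ - m) j m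
  rw [nsmul_eq_mul, sub_add_cancel] at this
  rw [Nat.add_sub_cancel, pow_add, mul_pow]
  linear_combination (y ^ j * y ^ m * a ^ j) * this

theorem neg_one_pow_mul_choose_nonneg {r : ℝ} (hr : r ≤ 0) (j : ℕ) :
    0 ≤ (-1) ^ j * Ring.choose r j := by
  induction j with
  | zero => simp
  | succ j ih =>
    have h1 := Ring.succ_mul_choose_succ r j
    have h3 : (0 : ℝ) < (j : ℝ) + 1 := by positivity
    have : 0 ≤ ((j : ℝ) + 1) * ((-1) ^ (j + 1) * Ring.choose r (j + 1)) := by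
      have e : ((j : ℝ) + 1) * ((-1) ^ (j + 1) * Ring.choose r (j + 1))
          = (j - r) * ((-1) ^ j * Ring.choose r j) := by
        linear_combination (-1) ^ (j + 1) * h1
      rw [e]
      exact mul_nonneg (by linarith [(Nat.cast_nonneg j : (0 : ℝ) ≤ j)]) ih
    exact nonneg_of_mul_nonneg_right this h3

theorem hasSum_abs_choose {κ y M : ℝ} {n : ℕ} (hκ : κ ≤ n) (hy : 0 ≤ y) (hM : 0 ≤ M)
    (h : M * y < 1) :
    HasSum (fun h : ℕ => |Ring.choose κ h * y ^ h| * ((h.choose n : ℝ) * M ^ (h - n)))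
      (|Ring.choose κ n| * y ^ n * (1 - M * y) ^ (κ - n)) := by
  have hs := (hasSum_choose_mul_coeff (κ := κ - n) (y := y) (a := -M)
    (by rw [neg_mul, abs_neg, abs_of_nonneg (mul_nonneg hM hy)]; exact h) 0).mul_left
      (|Ring.choose κ n| * y ^ n)
  rw [← hasSum_nat_add_iff' n]
  have h0 : ∑ i ∈ Finset.range n,
      |Ring.choose κ i * y ^ i| * ((i.choose n : ℝ) * M ^ (i - n)) = 0 :=
    Finset.sum_eq_zero fun i hi => by
      rw [Nat.choose_eq_zero_of_lt (Finset.mem_range.1 hi)]; simp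
  rw [h0, sub_zero]
  simp only [Ring.choose_zero_right, pow_zero, one_mul, Nat.choose_zero_right, Nat.cast_one,
    Nat.cast_zero, sub_zero, neg_mul, ← sub_eq_add_neg] at hs
  refine hs.congr_fun ?_
  intro j
  have h1 := Ring.choose_add_smul_choose (κ - n) j n
  rw [nsmul_eq_mul, sub_add_cancel] at h1
  have h2 := neg_one_pow_mul_choose_nonneg (r := κ - n) (by linarith) j
  have h3 := congrArg abs h1
  rw [abs_mul, abs_mul, Nat.abs_cast] at h3
  have h4 : |Ring.choose (κ - n) j| = (-1) ^ j * Ring.choose (κ - n) j := by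
    rw [← abs_of_nonneg h2, abs_mul, abs_pow, abs_neg, abs_one, one_pow, one_mul]
  rw [h4] at h3
  rw [Nat.add_sub_cancel, abs_mul, abs_of_nonneg (pow_nonneg hy _), pow_add, Nat.sub_zero,
    neg_pow M j]
  linear_combination (y ^ j * y ^ n * M ^ j) * h3

section ResidueSum

open PowerSeries Finset

variable {ι F : Type*} [Fintype ι] [DecidableEq ι] [Field F]

/-- The local cofactor at the node `α j`: the expansion in `X = z - α j` of
`∏ l ≠ j, (z - α l) ^ (-k l)`. -/
noncomputable def cofactor (α : ι → F) (k : ι → ℕ) (j : ι) : F⟦X⟧ :=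
  ∏ l ∈ univ.erase j, (X + C (α j - α l))⁻¹ ^ k l

/-- The sum over the nodes `α j` of the residues of `G / ∏ l, (z - α l) ^ k l`, where `G j` is
the expansion of `G` in `X = z - α j`. -/
noncomputable def resSum (α : ι → F) (k : ι → ℕ) (G : ι → F⟦X⟧) : F :=
  ∑ j, coeff (k j) (X * G j * cofactor α k j)

theorem resSum_add (α : ι → F) (k : ι → ℕ) (G H : ι → F⟦X⟧) :
    resSum α k (G + H) = resSum α k G + resSum α k H := by
  simp [resSum, mul_add, add_mul, sum_add_distrib]

theorem resSum_C_mul (α : ι → F) (k : ι → ℕ) (c : F) (G : ι → F⟦X⟧) :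
    resSum α k (fun j => C c * G j) = c * resSum α k G := by
  simp only [resSum, mul_sum]
  refine sum_congr rfl fun j _ => ?_
  rw [← coeff_C_mul]
  congr 1
  ring

theorem X_add_C_mul_inv {d : F} (hd : d ≠ 0) : (X + C d) * (X + C d)⁻¹ = (1 : F⟦X⟧) :=
  PowerSeries.mul_inv_cancel _ (by simpa using hd)

theorem resSum_shift {α : ι → F} (hα : Function.Injective α) (k : ι → ℕ) (a : ι)
    (G : ι → F⟦X⟧) :
    resSum α (k + Pi.single a 1) (fun j => (X + C (α j - α a)) * G j) = resSum α k G := by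
  refine sum_congr rfl fun j _ => ?_
  by_cases h : j = a
  · subst h
    have : cofactor α (k + Pi.single j 1) j = cofactor α k j :=
      prod_congr rfl fun l hl => by simp [Pi.single_eq_of_ne (ne_of_mem_erase hl)]
    rw [this]
    simp only [Pi.add_apply, Pi.single_eq_same, sub_self, map_zero, add_zero]
    rw [mul_assoc, coeff_succ_X_mul]
  · have ha : a ∈ univ.erase j := by simp [Ne.symm h]
    have hd : α j - α a ≠ 0 := sub_ne_zero.2 (hα.ne h)
    have : (X + C (α j - α a)) * cofactor α (k + Pi.single a 1) j = cofactor α k j := by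
      unfold cofactor
      rw [← mul_prod_erase _ _ ha, ← mul_prod_erase _ _ ha]
      have : ∏ l ∈ (univ.erase j).erase a, (X + C (α j - α l))⁻¹ ^ (k + Pi.single a 1 : ι → ℕ) l
          = ∏ l ∈ (univ.erase j).erase a, (X + C (α j - α l))⁻¹ ^ k l :=
        prod_congr rfl fun l hl => by simp [Pi.single_eq_of_ne (ne_of_mem_erase hl)]
      rw [this]
      simp only [Pi.add_apply, Pi.single_eq_same, pow_succ]
      linear_combination ((X + C (α j - α a))⁻¹ ^ k a *
        ∏ l ∈ (univ.erase j).erase a, (X + C (α j - α l))⁻¹ ^ k l) * X_add_C_mul_inv hd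
    rw [← this]
    simp only [Pi.add_apply, Pi.single_eq_of_ne h, add_zero]
    congr 1
    ring

theorem resSum_single (α : ι → F) (a : ι) (n : ℕ) :
    resSum α (Pi.single a n) 1 = if n = 1 then 1 else 0 := by
  unfold resSum
  rw [sum_eq_single a]
  · have : cofactor α (Pi.single a n) a = 1 :=
      prod_eq_one fun l hl => by simp [Pi.single_eq_of_ne (ne_of_mem_erase hl)]
    simp [this, coeff_X]
  · intro j _ hj
    simp [Pi.single_eq_of_ne hj]
  · simp

theorem resSum_zero (α : ι → F) (G : ι → F⟦X⟧) : resSum α 0 G = 0 := by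
  simp [resSum]

theorem resSum_one {α : ι → F} (hα : Function.Injective α) (n : ℕ) :
    ∀ k : ι → ℕ, ∑ j, k j = n + 1 → resSum α k 1 = if n = 0 then 1 else 0 := by
  induction n with
  | zero =>
    intro k hk
    obtain ⟨a, -, ha⟩ := exists_ne_zero_of_sum_ne_zero (s := univ) (f := k) (by omega)
    have h1 := add_sum_erase univ k (mem_univ a)
    have : k = Pi.single a 1 := by
      funext j
      by_cases h : j = a
      · subst h; simp; omega
      · have := single_le_sum (f := k) (fun i _ => Nat.zero_le _) (mem_erase.2 ⟨h, mem_univ j⟩)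
        simp [h]; omega
    rw [this, resSum_single]; simp
  | succ n ih =>
    intro k hk
    obtain ⟨a, -, ha⟩ := exists_ne_zero_of_sum_ne_zero (s := univ) (f := k) (by omega)
    have h1 := add_sum_erase univ k (mem_univ a)
    by_cases hb : ∃ b, b ≠ a ∧ k b ≠ 0
    · obtain ⟨b, hba, hb⟩ := hb
      obtain ⟨k', rfl⟩ : ∃ k' : ι → ℕ, k = k' + Pi.single a 1 + Pi.single b 1 := by
        refine ⟨k - Pi.single a 1 - Pi.single b 1, ?_⟩
        funext j
        by_cases h : j = a
        · subst h; simp [Pi.single_eq_of_ne hba.symm]; omega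
        · by_cases h' : j = b
          · subst h'; simp [h]; omega
          · simp [h, h']
      have hs : ∑ j, k' j = n := by
        simp [sum_add_distrib] at hk; omega
      have e1 := resSum_shift hα (k' + Pi.single a 1) b 1
      have e2 := resSum_shift hα (k' + Pi.single b 1) a 1
      rw [add_right_comm] at e2
      rw [ih _ (by simp [sum_add_distrib, hs])] at e1 e2
      have e3 := resSum_add α (k' + Pi.single a 1 + Pi.single b 1)
        (fun j => C (α a - α b) * (1 : ι → F⟦X⟧) j)
        (fun j => (X + C (α j - α a)) * (1 : ι → F⟦X⟧) j)
      rw [resSum_C_mul, e2] at e3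
      have e4 : ((fun j => C (α a - α b) * (1 : ι → F⟦X⟧) j) +
        (fun j => (X + C (α j - α a)) * (1 : ι → F⟦X⟧) j)) =
        (fun j => (X + C (α j - α b)) * (1 : ι → F⟦X⟧) j) := by
        funext j
        simp only [Pi.add_apply, map_sub]
        ring
      rw [e4, e1] at e3
      have : (α a - α b) * resSum α (k' + Pi.single a 1 + Pi.single b 1) 1 = 0 := by
        linear_combination -e3
      simpa [sub_ne_zero.2 (hα.ne hba.symm)] using this
    · push Not at hb
      have h2 : ∑ j ∈ univ.erase a, k j = 0 :=
        sum_eq_zero fun j hj => hb j (ne_of_mem_erase hj)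
      have : k = Pi.single a (n + 2) := by
        funext j
        by_cases h : j = a
        · subst h; simp; omega
        · simp [h, hb j h]
      rw [this, resSum_single]; simp

theorem resSum_pow_succ {α : ι → F} (hα : Function.Injective α) (k : ι → ℕ) (a : ι) (h : ℕ) :
    resSum α (k + Pi.single a 1) (fun j => (X + C (α j)) ^ (h + 1)) =
      α a * resSum α (k + Pi.single a 1) (fun j => (X + C (α j)) ^ h) +
        resSum α k (fun j => (X + C (α j)) ^ h) := by
  rw [← resSum_shift hα k a, ← resSum_C_mul, ← resSum_add]
  congr 1
  funext j
  simp only [Pi.add_apply, map_sub]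
  ring

theorem abs_resSum_pow_le {α : ι → ℝ} (hα : Function.Injective α) {M : ℝ}
    (hM : ∀ j, |α j| ≤ M) (h : ℕ) : ∀ (n : ℕ) (k : ι → ℕ), ∑ j, k j = n + 1 →
    |resSum α k (fun j => (X + C (α j)) ^ h)| ≤ (h.choose n : ℝ) * M ^ (h - n) := by
  induction h with
  | zero =>
    intro n k hk
    have := resSum_one hα n k hk
    simp only [pow_zero]
    change |resSum α k 1| ≤ _
    rw [this]
    rcases n with _ | n <;> simp
  | succ h ih =>
    intro n k hk
    obtain ⟨a, -, ha⟩ := exists_ne_zero_of_sum_ne_zero (s := univ) (f := k) (by omega)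
    have hM0 : 0 ≤ M := (abs_nonneg _).trans (hM a)
    obtain ⟨k', rfl⟩ : ∃ k' : ι → ℕ, k = k' + Pi.single a 1 := by
      refine ⟨k - Pi.single a 1, ?_⟩
      funext j
      by_cases h : j = a
      · subst h; simp; omega
      · simp [h]
    have hs : ∑ j, k' j = n := by
      simp [sum_add_distrib] at hk; omega
    rw [resSum_pow_succ hα]
    refine (abs_add_le _ _).trans ?_
    rw [abs_mul]
    have i1 := mul_le_mul (hM a) (ih n _ hk) (abs_nonneg _) hM0
    rcases n with _ | n
    · have : k' = 0 := by
        funext j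
        exact (sum_eq_zero_iff.1 hs) j (mem_univ j)
      subst this
      rw [resSum_zero, abs_zero, add_zero]
      refine i1.trans (le_of_eq ?_)
      simp [pow_succ']
    · have i2 := ih n k' hs
      refine (add_le_add i1 i2).trans (le_of_eq ?_)
      rw [Nat.choose_succ_succ, Nat.add_sub_add_right]
      rcases Nat.lt_or_ge n h with hlt | hge
      · rw [show h - n = (h - (n + 1)) + 1 by omega, pow_succ]
        push_cast; ring
      · rw [Nat.choose_eq_zero_of_lt (by omega : h < n + 1)]
        push_cast; ring

end ResidueSum

section Germ

open PowerSeries Finset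

/-- The expansion in `X = z - a` of `(1 + z * y) ^ (k + 1 / 2) / (1 + a * y) ^ (1 / 2)`. -/
noncomputable def germ (y : ℝ) (k : ℕ) (a : ℝ) : ℝ⟦X⟧ :=
  C ((1 + a * y) ^ k) *
    rescale (y / (1 + a * y)) (PowerSeries.binomialSeries ℝ ((k : ℝ) + 1 / 2))

theorem coeff_germ (y : ℝ) (k : ℕ) (a : ℝ) (m : ℕ) :
    coeff m (germ y k a) =
      (1 + a * y) ^ k * ((y / (1 + a * y)) ^ m * Ring.choose ((k : ℝ) + 1 / 2) m) := by
  rw [germ, coeff_C_mul, coeff_rescale, PowerSeries.binomialSeries_coeff, smul_eq_mul, mul_one]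

theorem hasSum_coeff_germ {y a : ℝ} (h : |a * y| < 1) (k m : ℕ) :
    HasSum (fun n : ℕ => Ring.choose ((k : ℝ) + 1 / 2) n * y ^ n * coeff m ((X + C a) ^ n))
      (coeff m (C (√(1 + a * y)) * germ y k a)) := by
  have h0 : 0 < 1 + a * y := by linarith [(abs_lt.1 h).1]
  have hs := hasSum_choose_mul_coeff (κ := (k : ℝ) + 1 / 2) h m
  convert hs using 1
  · funext n
    congr 1
    have : ((X + C a) ^ n : ℝ⟦X⟧) =
        (((Polynomial.X + Polynomial.C a) ^ n : Polynomial ℝ) : ℝ⟦X⟧) := by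
      simp
    rw [this, Polynomial.coeff_coe, Polynomial.coeff_X_add_C_pow, mul_comm]
  · rw [coeff_C_mul, coeff_germ, show (k : ℝ) + 1 / 2 - m = 1 / 2 + k - m by ring,
      Real.rpow_sub h0, Real.rpow_add h0, Real.rpow_natCast, Real.rpow_natCast,
      ← Real.sqrt_eq_rpow, div_pow]
    ring

variable {ι : Type*} [Fintype ι] [DecidableEq ι]

theorem hasSum_resSum {α : ι → ℝ} {c : ℕ → ℝ} {G : ℕ → ι → ℝ⟦X⟧} {Φ : ι → ℝ⟦X⟧}
    (h : ∀ j m, HasSum (fun n => c n * coeff m (G n j)) (coeff m (Φ j))) (k : ι → ℕ) :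
    HasSum (fun n => c n * resSum α k (G n)) (resSum α k Φ) := by
  simp only [resSum, mul_sum]
  refine hasSum_sum fun j _ => ?_
  have e : ∀ g : ℝ⟦X⟧, coeff (k j) (X * g * cofactor α k j) =
      ∑ p ∈ antidiagonal (k j), coeff p.1 g * coeff p.2 (X * cofactor α k j) := fun g => by
    rw [← coeff_mul]; congr 1; ring
  simp only [e, mul_sum, ← mul_assoc]
  exact hasSum_sum fun p _ => (h j p.1).mul_right _

theorem abs_resSum_germ_le {α : ι → ℝ} (hα : Function.Injective α) {M y : ℝ} (hy : 0 ≤ y)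
    (hM0 : 0 ≤ M) (hM : ∀ j, |α j| ≤ M) (hMy : M * y < 1) {k : ι → ℕ} {n r : ℕ}
    (hk : ∑ j, k j = n + 1) (hr : (r : ℝ) + 1 / 2 ≤ n) :
    |resSum α k (fun j => C (√(1 + α j * y)) * germ y r (α j))| ≤
      |Ring.choose ((r : ℝ) + 1 / 2) n| * y ^ n * (1 - M * y) ^ ((r : ℝ) + 1 / 2 - n) := by
  have h1 := hasSum_resSum (α := α) (c := fun n => Ring.choose ((r : ℝ) + 1 / 2) n * y ^ n)
    (G := fun n j => (X + C (α j)) ^ n) (fun j m => hasSum_coeff_germ (a := α j) (y := y) (by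
      rw [abs_mul, abs_of_nonneg hy]
      exact (mul_le_mul_of_nonneg_right (hM j) hy).trans_lt hMy) r m) k
  have h2 := hasSum_abs_choose hr hy hM0 hMy
  rw [← Real.norm_eq_abs]
  refine h1.norm_le_of_bounded h2 fun h => ?_
  rw [Real.norm_eq_abs, abs_mul]
  exact mul_le_mul_of_nonneg_left (abs_resSum_pow_le hα hM h n k hk) (abs_nonneg _)

end Germ

section Nonvanishing

open PowerSeries Finset

variable {ι F : Type*} [Fintype ι] [DecidableEq ι] [Field F]

theorem germ_ode {y a : ℝ} (h : 1 + a * y ≠ 0) (k : ℕ) :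
    (1 + C y * (X + C a)) * derivative ℝ (germ y k a) =
      C (y * ((k : ℝ) + 1 / 2)) * germ y k a := by
  have e : (1 + C y * (X + C a) : ℝ⟦X⟧) = C (1 + a * y) + C y * X := by
    simp only [map_add, map_mul, map_one]; ring
  ext m
  rw [e, add_mul, map_add, coeff_C_mul, coeff_C_mul, mul_assoc, coeff_C_mul]
  have hc : ∀ m, coeff (m + 1) (germ y k a) * ((m : ℝ) + 1) * (1 + a * y) =
      y * ((k : ℝ) + 1 / 2 - m) * coeff m (germ y k a) := fun m => by
    have := Ring.succ_mul_choose_succ ((k : ℝ) + 1 / 2) m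
    have hu : y / (1 + a * y) * (1 + a * y) = y := div_mul_cancel₀ _ h
    rw [coeff_germ, coeff_germ, pow_succ]
    linear_combination (1 + a * y) ^ k * (y / (1 + a * y)) ^ m * (y * this +
      Ring.choose ((k : ℝ) + 1 / 2) (m + 1) * (m + 1) * hu)
  have h0 := hc m
  rcases m with _ | m
  · simp only [coeff_zero_X_mul, coeff_derivative]
    push_cast at h0 ⊢
    linear_combination h0
  · rw [coeff_succ_X_mul, coeff_derivative, coeff_derivative]
    push_cast at h0 ⊢
    linear_combination h0

/-- The moment functional `q ↦ resSum (q * G)` for `k + 1`-fold nodes. -/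
noncomputable def moment (α : ι → F) (k : ι → ℕ) (G : ι → F⟦X⟧) : Polynomial F →ₗ[F] F where
  toFun q := resSum α k (fun j => Polynomial.aeval (X + C (α j)) q * G j)
  map_add' p q := by
    rw [← resSum_add]; congr 1; funext j; simp [add_mul]
  map_smul' c q := by
    rw [RingHom.id_apply, smul_eq_mul, ← resSum_C_mul]; congr 1; funext j
    simp [smul_eq_C_mul, mul_assoc]

theorem moment_X_sub_C_mul {α : ι → F} (hα : Function.Injective α) (k : ι → ℕ) (a : ι)
    (G : ι → F⟦X⟧) (q : Polynomial F) :
    moment α (k + Pi.single a 1) G ((Polynomial.X - Polynomial.C (α a)) * q) =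
      moment α k G q := by
  change resSum _ _ _ = resSum _ _ _
  rw [← resSum_shift hα k a]
  congr 1
  funext j
  simp only [map_mul, map_sub, Polynomial.aeval_X, Polynomial.aeval_C]
  change (X + C (α j) - C (α a)) * _ * _ = _
  ring

theorem moment_prod_mul {α : ι → F} (hα : Function.Injective α) (s : Finset ι) (k : ι → ℕ)
    (m : ι → ℕ) (G : ι → F⟦X⟧) (q : Polynomial F) :
    moment α (k + ∑ a ∈ s, Pi.single a (m a)) G
      ((∏ a ∈ s, (Polynomial.X - Polynomial.C (α a)) ^ m a) * q) = moment α k G q := by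
  induction s using Finset.induction_on generalizing k with
  | empty => simp
  | insert a s ha ih =>
    rw [sum_insert ha, prod_insert ha]
    have : ∀ r : ℕ, moment α (k + (Pi.single a r + ∑ a ∈ s, Pi.single a (m a))) G
      ((Polynomial.X - Polynomial.C (α a)) ^ r *
        (∏ a ∈ s, (Polynomial.X - Polynomial.C (α a)) ^ m a) * q) = moment α k G q := by
      intro r
      induction r with
      | zero => simpa using ih k
      | succ r ihr =>
        have hs : (Pi.single a (r + 1) : ι → ℕ) = Pi.single a r + Pi.single a 1 :=
          Pi.single_add (f := fun _ => ℕ) a r 1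
        rw [← ihr, pow_succ', hs,
          show k + (Pi.single a r + Pi.single a 1 + ∑ a ∈ s, Pi.single a (m a)) =
            k + (Pi.single a r + ∑ a ∈ s, Pi.single a (m a)) + Pi.single a 1 by abel,
          mul_assoc, mul_assoc, moment_X_sub_C_mul hα, ← mul_assoc]
    exact this (m a)

/-- The numerator of the derivative of `q * (1 + y * z) * G / p ^ k` over `G / p ^ (k + 1)`, when
`(1 + y * z) * G' = y * κ * G`. -/
noncomputable def exactForm (y κ : F) (k : ℕ) (p q : Polynomial F) : Polynomial F :=
  Polynomial.derivative (q * (1 + Polynomial.C y * Polynomial.X)) * p +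
    Polynomial.C (y * κ) * (q * p) -
    Polynomial.C (k : F) * (q * (1 + Polynomial.C y * Polynomial.X) * Polynomial.derivative p)

theorem derivative_pow_of_mul_eq_one {P B : F⟦X⟧} (h : B * P = 1) (k : ℕ) :
    derivative F (B ^ k) = -(C (k : F) * (B ^ (k + 1) * derivative F P)) := by
  have h1 : B * derivative F P + P * derivative F B = 0 := by
    have := congrArg (derivative F) h
    simpa using this
  induction k with
  | zero => simp
  | succ k ih =>
    rw [pow_succ, Derivation.leibniz, ih, smul_eq_mul, smul_eq_mul]
    push_cast
    simp only [map_add, map_one]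
    linear_combination B ^ (k + 1) * h1 - B ^ k * derivative F B * h

theorem coeff_exactForm {y κ a : F} {k : ℕ} {p q : Polynomial F} {P B G : F⟦X⟧}
    (hG : (1 + C y * (X + C a)) * derivative F G = C (y * κ) * G) (hB : B * P = 1)
    (hp : Polynomial.aeval (X + C a) p = X * P) :
    coeff (k + 1) (X * (Polynomial.aeval (X + C a) (exactForm y κ k p q) * G) * B ^ (k + 1)) =
      0 := by
  have hD : ∀ f : Polynomial F, derivative F (Polynomial.aeval (X + C a : F⟦X⟧) f) =
      Polynomial.aeval (X + C a) (Polynomial.derivative f) := fun f => by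
    rw [Derivation.map_aeval]
    simp
  have hCa : ∀ c : F, Polynomial.aeval (X + C a : F⟦X⟧) (Polynomial.C c) = C c := fun c => by
    rw [Polynomial.aeval_C]; rfl
  set Q : F⟦X⟧ := Polynomial.aeval (X + C a) (q * (1 + Polynomial.C y * Polynomial.X)) with hQ
  have hp' : Polynomial.aeval (X + C a : F⟦X⟧) (Polynomial.derivative p) =
      P + X * derivative F P := by
    rw [← hD, hp, Derivation.leibniz]
    simp [add_comm]
  have hQ1 : Q = Polynomial.aeval (X + C a : F⟦X⟧) q * (1 + C y * (X + C a)) := by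
    rw [hQ, map_mul, map_add, map_mul, hCa, Polynomial.aeval_X, map_one]
  have key : X * (Polynomial.aeval (X + C a) (exactForm y κ k p q) * G) * B ^ (k + 1) =
      X * (X * derivative F (Q * G * B ^ k) - C (k : F) * (Q * G * B ^ k)) := by
    have E : Polynomial.aeval (X + C a : F⟦X⟧) (exactForm y κ k p q) =
        Polynomial.aeval (X + C a)
          (Polynomial.derivative (q * (1 + Polynomial.C y * Polynomial.X))) *
            Polynomial.aeval (X + C a) p +
          Polynomial.aeval (X + C a) (Polynomial.C (y * κ)) *
            (Polynomial.aeval (X + C a) q * Polynomial.aeval (X + C a) p) -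
          Polynomial.aeval (X + C a) (Polynomial.C (k : F)) *
            (Q * Polynomial.aeval (X + C a) (Polynomial.derivative p)) := by
      rw [hQ, exactForm]
      simp only [← map_mul (Polynomial.aeval (X + C a : F⟦X⟧)), ← map_add, ← map_sub]
    rw [E, ← hD, ← hQ, hCa, hCa, hp', hp, Derivation.leibniz, Derivation.leibniz,
      derivative_pow_of_mul_eq_one hB]
    simp only [smul_eq_mul]
    have e : Q * derivative F G = C (y * κ) * (Polynomial.aeval (X + C a : F⟦X⟧) q * G) := by
      rw [hQ1]
      linear_combination Polynomial.aeval (X + C a : F⟦X⟧) q * hG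
    linear_combination (X * X * derivative F Q * G * B ^ k - X * X * B ^ k *
      (-(C (y * κ)) * (Polynomial.aeval (X + C a : F⟦X⟧) q * G)) -
      X * C (k : F) * Q * G * B ^ k) * hB - X * X * B ^ k * e
  rw [key, coeff_succ_X_mul, map_sub, coeff_C_mul]
  rcases k with _ | k
  · simp
  · rw [coeff_succ_X_mul, coeff_derivative]
    push_cast
    ring

theorem moment_exactForm {α : ι → F} (hα : Function.Injective α) {y κ : F} (k : ℕ)
    {G : ι → F⟦X⟧}
    (hG : ∀ j, (1 + C y * (X + C (α j))) * derivative F (G j) = C (y * κ) * G j)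
    (q : Polynomial F) :
    moment α (fun _ => k + 1) G
      (exactForm y κ k (∏ l, (Polynomial.X - Polynomial.C (α l))) q) = 0 := by
  refine sum_eq_zero fun j _ => ?_
  have : cofactor α (fun _ => k + 1) j = (∏ l ∈ univ.erase j, (X + C (α j - α l))⁻¹) ^ (k + 1) := by
    rw [cofactor, prod_pow]
  rw [this]
  refine coeff_exactForm (P := ∏ l ∈ univ.erase j, (X + C (α j - α l))) (hG j) ?_ ?_
  · rw [← prod_mul_distrib]
    refine prod_eq_one fun l hl => ?_
    rw [mul_comm, X_add_C_mul_inv (sub_ne_zero.2 (hα.ne (ne_of_mem_erase hl).symm))]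
  · rw [map_prod, ← mul_prod_erase _ _ (mem_univ j)]
    congr 1
    · simp only [map_sub, Polynomial.aeval_X, Polynomial.aeval_C]
      exact add_sub_cancel_right X (C (α j))
    · refine prod_congr rfl fun l _ => ?_
      simp only [map_sub, Polynomial.aeval_X, Polynomial.aeval_C]
      exact add_sub_assoc X (C (α j)) (C (α l))

theorem moment_eq_zero_of_degree_lt {α : ι → F} (hα : Function.Injective α) (k : ℕ)
    {G : ι → F⟦X⟧} (h0 : ∀ a, resSum α ((fun _ => k) + Pi.single a 1) G = 0)
    {q : Polynomial F} (hq : q.degree < Fintype.card ι) :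
    moment α (fun _ => k + 1) G q = 0 := by
  have h1 : ∀ a, moment α (fun _ => k + 1) G
      (∏ l ∈ univ.erase a, (Polynomial.X - Polynomial.C (α l))) = 0 := fun a => by
    have e := moment_prod_mul hα (univ.erase a) ((fun _ => k) + Pi.single a 1) (fun _ => 1) G 1
    have e1 : ((fun _ => k) + Pi.single a 1 + ∑ b ∈ univ.erase a, Pi.single b 1 : ι → ℕ) =
        fun _ => k + 1 := by
      rw [add_assoc, add_sum_erase univ (fun b => (Pi.single b 1 : ι → ℕ)) (mem_univ a)]
      funext j
      simp [Finset.sum_apply, Pi.single_apply]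
    rw [e1] at e
    simp only [pow_one, mul_one] at e
    rw [e, ← h0 a]
    change resSum _ _ _ = _
    simp
  rw [Lagrange.eq_interpolate (s := univ) (v := α) hα.injOn hq, Lagrange.interpolate_apply,
    map_sum]
  refine sum_eq_zero fun a _ => ?_
  have e : Lagrange.basis univ α a = Polynomial.C (∏ l ∈ univ.erase a, (α a - α l)⁻¹) *
      ∏ l ∈ univ.erase a, (Polynomial.X - Polynomial.C (α l)) := by
    rw [map_prod, ← prod_mul_distrib]
    rfl
  rw [e, ← mul_assoc, ← map_mul, ← Polynomial.smul_eq_C_mul, map_smul, h1, smul_zero]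

theorem exactForm_X_pow {y κ : F} {k m n : ℕ} {p : Polynomial F} (hp : p.Monic)
    (hn : p.natDegree = n + 1) :
    (exactForm y κ k p (Polynomial.X ^ m) -
      (y * (m + 1 + κ - k * (n + 1))) • Polynomial.X ^ (m + n + 1)).degree < ↑(m + n + 1) := by
  have e : (Polynomial.X ^ m * (1 + Polynomial.C y * Polynomial.X) : Polynomial F) =
      Polynomial.X ^ m + Polynomial.C y * Polynomial.X ^ (m + 1) := by ring
  have h1 : (Polynomial.X ^ m * (1 + Polynomial.C y * Polynomial.X) : Polynomial F).natDegree ≤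
      m + 1 := by
    rw [e]; compute_degree!
  have c1 : (Polynomial.X ^ m * (1 + Polynomial.C y * Polynomial.X) : Polynomial F).coeff (m + 1) =
      y := by
    rw [e]; simp [Polynomial.coeff_X_pow]
  have h2 := Polynomial.natDegree_derivative_le
    (Polynomial.X ^ m * (1 + Polynomial.C y * Polynomial.X) : Polynomial F)
  have h3 := Polynomial.natDegree_derivative_le p
  have cp : p.coeff (n + 1) = 1 := hn ▸ hp
  have hx : (Polynomial.X ^ m : Polynomial F).natDegree ≤ m := Polynomial.natDegree_X_pow_le m
  have d1 : (exactForm y κ k p (Polynomial.X ^ m)).natDegree ≤ m + n + 1 := by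
    refine (Polynomial.natDegree_sub_le_of_le (Polynomial.natDegree_add_le_of_le
      (Polynomial.natDegree_mul_le_of_le (h2.trans (Nat.sub_le_sub_right h1 1)) hn.le)
      ((Polynomial.natDegree_C_mul_le _ _).trans (Polynomial.natDegree_mul_le_of_le hx hn.le)))
      ((Polynomial.natDegree_C_mul_le _ _).trans
        (Polynomial.natDegree_mul_le_of_le h1 h3))).trans ?_
    rw [hn]
    simp
    omega
  have c2 : (exactForm y κ k p (Polynomial.X ^ m)).coeff (m + n + 1) =
      y * (m + 1 + κ - k * (n + 1)) := by
    have a1 := Polynomial.coeff_mul_add_eq_of_natDegree_le (h2.trans (Nat.sub_le_sub_right h1 1))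
      hn.le
    have a2 := Polynomial.coeff_mul_add_eq_of_natDegree_le hx hn.le
    have a3 :=
      Polynomial.coeff_mul_add_eq_of_natDegree_le h1 (h3.trans (Nat.sub_le_sub_right hn.le 1))
    rw [Nat.add_sub_cancel] at a1 a3
    rw [cp, Polynomial.coeff_derivative, c1] at a1
    rw [cp, Polynomial.coeff_X_pow_self] at a2
    rw [c1, Polynomial.coeff_derivative, cp] at a3
    rw [exactForm, Polynomial.coeff_sub, Polynomial.coeff_add, Polynomial.coeff_C_mul,
      Polynomial.coeff_C_mul, show m + n + 1 = m + (n + 1) by ring, a1, a2,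
      show m + (n + 1) = m + 1 + n by ring, a3]
    ring
  rw [Polynomial.degree_lt_iff_coeff_zero]
  intro i hi
  rw [Polynomial.coeff_sub, Polynomial.coeff_smul, Polynomial.coeff_X_pow]
  rcases hi.eq_or_lt with rfl | h
  · rw [c2]; simp
  · rw [Polynomial.coeff_eq_zero_of_natDegree_lt (d1.trans_lt h)]
    simp [h.ne']

theorem constantCoeff_eq_zero_of_resSum_eq_zero {α : ι → F} (hα : Function.Injective α)
    {y κ : F} {k : ℕ} {G : ι → F⟦X⟧}
    (hG : ∀ j, (1 + C y * (X + C (α j))) * derivative F (G j) = C (y * κ) * G j)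
    (hy : ∀ n : ℕ, y * (n + 1 + κ - k * Fintype.card ι) ≠ 0)
    (h0 : ∀ a, resSum α ((fun _ => k) + Pi.single a 1) G = 0) (j : ι) :
    constantCoeff (G j) = 0 := by
  obtain ⟨N, hN⟩ : ∃ N, Fintype.card ι = N + 1 :=
    Nat.exists_eq_succ_of_ne_zero (Fintype.card_pos_iff.2 ⟨j⟩).ne'
  set μ := moment α (fun _ => k + 1) G
  have hlt : ∀ n, ∀ q : Polynomial F, q.degree < (n : ℕ) → μ q = 0 := by
    intro n
    induction n with
    | zero =>
      intro q hq
      have : q = 0 := Polynomial.ext fun i =>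
        (Polynomial.degree_lt_iff_coeff_zero q 0).1 hq i (Nat.zero_le i)
      rw [this, map_zero]
    | succ n ih =>
      have hX : μ (Polynomial.X ^ n) = 0 := by
        rcases Nat.lt_or_ge n (Fintype.card ι) with h | h
        · exact moment_eq_zero_of_degree_lt hα k h0 (by simpa using h)
        · obtain ⟨m, rfl⟩ : ∃ m, n = m + N + 1 := ⟨n - Fintype.card ι, by omega⟩
          have hm := exactForm_X_pow (y := y) (κ := κ) (k := k) (m := m) (n := N)
            (Polynomial.monic_prod_X_sub_C α univ)
            (by rw [Polynomial.natDegree_finsetProd_X_sub_C_eq_card, card_univ, hN])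
          have := ih _ hm
          rw [map_sub, moment_exactForm hα k hG, map_smul, zero_sub, neg_eq_zero,
            smul_eq_mul] at this
          refine (mul_eq_zero.1 this).resolve_left ?_
          have := hy m
          rw [hN] at this
          exact_mod_cast this
      intro q hq
      have h1 : (q - q.coeff n • Polynomial.X ^ n).degree < ↑n := by
        rw [Polynomial.degree_lt_iff_coeff_zero] at hq ⊢
        intro i hi
        rw [Polynomial.coeff_sub, Polynomial.coeff_smul, Polynomial.coeff_X_pow]
        rcases hi.eq_or_lt with rfl | h
        · simp
        · rw [hq i h]; simp [h.ne']
      have := ih _ h1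
      rwa [map_sub, map_smul, hX, smul_zero, sub_zero] at this
  have hall : ∀ q, μ q = 0 := fun q =>
    hlt (q.natDegree + 1) q
      (Polynomial.degree_le_natDegree.trans_lt (by exact_mod_cast Nat.lt_succ_self _))
  have e := moment_prod_mul hα univ (Pi.single j 1) (fun l => if l = j then k else k + 1) G 1
  have e1 : (Pi.single j 1 + ∑ b, Pi.single b (if b = j then k else k + 1) : ι → ℕ) =
      fun _ => k + 1 := by
    funext i
    simp only [Pi.add_apply, Finset.sum_apply, Pi.single_apply]
    simp
    split_ifs <;> omega
  rw [e1] at e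
  have e2 := e.symm.trans (hall _)
  change ∑ i, _ = _ at e2
  rw [sum_eq_single j (fun i _ hi => by simp [Pi.single_eq_of_ne hi]) (by simp)] at e2
  have e3 : cofactor α (Pi.single j 1) j = 1 :=
    prod_eq_one fun l hl => by simp [Pi.single_eq_of_ne (ne_of_mem_erase hl)]
  rw [e3] at e2
  simpa [coeff_succ_X_mul] using e2

end Nonvanishing

section Integrality

open PowerSeries Finset

/-- The coefficients of `f (d * X)` become integral after multiplication by `c`. -/
def IntScaled (d c : ℝ) (f : ℝ⟦X⟧) : Prop :=
  ∀ m, c * d ^ m * coeff m f ∈ (Int.castRingHom ℝ).range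

theorem IntScaled.one (d : ℝ) : IntScaled d 1 1 := fun m => by
  rw [coeff_one]
  split_ifs with h
  · simp [h]
  · simp

theorem IntScaled.mul {d c c' : ℝ} {f g : ℝ⟦X⟧} (hf : IntScaled d c f) (hg : IntScaled d c' g) :
    IntScaled d (c * c') (f * g) := fun m => by
  rw [coeff_mul, mul_sum]
  refine sum_mem fun p hp => ?_
  rw [← mem_antidiagonal.1 hp]
  convert mul_mem (hf p.1) (hg p.2) using 1
  ring

theorem IntScaled.pow {d c : ℝ} {f : ℝ⟦X⟧} (hf : IntScaled d c f) (n : ℕ) :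
    IntScaled d (c ^ n) (f ^ n) := by
  induction n with
  | zero => simpa using IntScaled.one d
  | succ n ih => rw [pow_succ, pow_succ]; exact ih.mul hf

theorem IntScaled.prod {ι : Type*} {d : ℝ} {s : Finset ι} {c : ι → ℝ} {f : ι → ℝ⟦X⟧}
    (h : ∀ i ∈ s, IntScaled d (c i) (f i)) : IntScaled d (∏ i ∈ s, c i) (∏ i ∈ s, f i) := by
  classical
  induction s using Finset.induction_on with
  | empty => simpa using IntScaled.one d
  | insert a s ha ih =>
    rw [prod_insert ha, prod_insert ha]
    exact (h a (mem_insert_self a s)).mul (ih fun i hi => h i (mem_insert_of_mem hi))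

theorem coeff_X_add_C_inv {F : Type*} [Field F] {d : F} (hd : d ≠ 0) (m : ℕ) :
    coeff m ((X + C d)⁻¹ : F⟦X⟧) = (-1) ^ m * d⁻¹ ^ (m + 1) := by
  have h : ((X + C d)⁻¹ : F⟦X⟧) = mk fun m => (-1) ^ m * d⁻¹ ^ (m + 1) := by
    rw [PowerSeries.inv_eq_iff_mul_eq_one (by simpa using hd)]
    ext n
    rw [mul_add, map_add, mul_comm _ (C d), coeff_C_mul, coeff_mk, coeff_one]
    rcases n with _ | n
    · simp [hd]
    · rw [coeff_succ_mul_X, coeff_mk, pow_succ' (d⁻¹) (n + 1), pow_succ' (-1 : F)]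
      rw [if_neg (Nat.succ_ne_zero n)]
      field_simp
      ring
  rw [h, coeff_mk]

theorem intScaled_X_add_C_inv {d e : ℝ} (hd : d ≠ 0) (he : e ∈ (Int.castRingHom ℝ).range) :
    IntScaled (d * e) d (X + C d)⁻¹ := fun m => by
  rw [coeff_X_add_C_inv hd]
  have : d * (d * e) ^ m * ((-1) ^ m * d⁻¹ ^ (m + 1)) = (-1) ^ m * e ^ m := by
    rw [mul_pow, pow_succ]
    have : d ^ m * d⁻¹ ^ m = 1 := by rw [← mul_pow, mul_inv_cancel₀ hd, one_pow]
    linear_combination (-1) ^ m * e ^ m * d * d⁻¹ * this + (-1) ^ m * e ^ m * mul_inv_cancel₀ hd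
  rw [this]
  exact mul_mem (pow_mem (neg_mem (one_mem _)) m) (pow_mem he m)

variable {ι : Type*} [Fintype ι] [DecidableEq ι]

theorem intScaled_cofactor {α : ι → ℝ} (hα : Function.Injective α)
    (hint : ∀ i j, α i - α j ∈ (Int.castRingHom ℝ).range) (k : ι → ℕ) (j : ι) :
    IntScaled (∏ l ∈ univ.erase j, (α j - α l)) (∏ l ∈ univ.erase j, (α j - α l) ^ k l)
      (cofactor α k j) := by
  refine IntScaled.prod fun l hl => IntScaled.pow ?_ (k l)
  rw [← mul_prod_erase _ _ hl]
  exact intScaled_X_add_C_inv (sub_ne_zero.2 (hα.ne (ne_of_mem_erase hl).symm))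
    (prod_mem fun _ _ => hint _ _)

theorem coeff_germ_mul_mem {N a δ e : ℝ} (hN : N ≠ 0) (h0 : N + 4 * a ≠ 0)
    (hδ : N + 4 * a = δ * e) (he : e ∈ (Int.castRingHom ℝ).range) {k m : ℕ} (hm : m ≤ k) :
    ∃ z ∈ (Int.castRingHom ℝ).range,
      N ^ k * coeff m (germ (4 / N) k a) = δ ^ (k - m) * z := by
  refine ⟨e ^ (k - m) * (4 ^ m * Ring.choose ((k : ℝ) + 1 / 2) m),
    mul_mem (pow_mem he _) (four_pow_mul_choose_half_mem k m), ?_⟩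
  rw [coeff_germ, ← mul_assoc (δ ^ _), ← mul_pow, ← hδ]
  have e1 : 1 + a * (4 / N) = (N + 4 * a) / N := by field_simp
  have e2 : 4 / N / ((N + 4 * a) / N) = 4 / (N + 4 * a) := by field_simp
  obtain ⟨r, rfl⟩ := Nat.exists_eq_add_of_le hm
  rw [e1, e2, div_pow, div_pow, Nat.add_sub_cancel_left, pow_add (N + 4 * a)]
  field_simp

theorem coeff_germ_mul_cofactor_mem {α : ι → ℝ} (hα : Function.Injective α)
    (hint : ∀ i j, α i - α j ∈ (Int.castRingHom ℝ).range) {N e : ℝ} (hN : N ≠ 0) {j : ι}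
    (h0 : N + 4 * α j ≠ 0) (hδ : N + 4 * α j = (∏ l ∈ univ.erase j, (α j - α l)) * e)
    (he : e ∈ (Int.castRingHom ℝ).range) (k : ℕ) (i : ι) :
    N ^ k * (∏ l ∈ univ.erase j, (α j - α l)) ^ k *
      coeff (((fun _ => k) + Pi.single i 1 : ι → ℕ) j)
        (X * germ (4 / N) k (α j) * cofactor α ((fun _ => k) + Pi.single i 1) j) ∈
      (Int.castRingHom ℝ).range := by
  set δ := ∏ l ∈ univ.erase j, (α j - α l) with hδ'
  have hc := intScaled_cofactor hα hint ((fun _ => k) + Pi.single i 1) j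
  rw [← hδ'] at hc
  obtain ⟨t, ht⟩ : ∃ t, t = ∏ l ∈ univ.erase j,
      (α j - α l) ^ ((fun _ => k) + Pi.single i 1 : ι → ℕ) l :=
    ⟨_, rfl⟩
  rw [← ht] at hc
  obtain ⟨n, hn⟩ : ∃ n, n = ((fun _ => k) + Pi.single i 1 : ι → ℕ) j := ⟨_, rfl⟩
  have hδt : ∃ s ∈ (Int.castRingHom ℝ).range, δ ^ (2 * k + 1 - n) = t * s ∧ n ≤ k + 1 := by
    by_cases h : j = i
    · subst h
      refine ⟨1, one_mem _, ?_⟩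
      rw [hn, ht]
      simp only [Pi.add_apply, Pi.single_eq_same]
      refine ⟨?_, le_rfl⟩
      rw [show 2 * k + 1 - (k + 1) = k by omega, mul_one, hδ', ← prod_pow]
      exact prod_congr rfl fun l hl => by simp [Pi.single_eq_of_ne (ne_of_mem_erase hl)]
    · have hi : i ∈ univ.erase j := by simp [Ne.symm h]
      refine ⟨∏ l ∈ (univ.erase j).erase i, (α j - α l), prod_mem fun _ _ => hint _ _, ?_⟩
      rw [hn, ht]
      simp only [Pi.add_apply, Pi.single_eq_of_ne h, add_zero]
      refine ⟨?_, by omega⟩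
      rw [show 2 * k + 1 - k = k + 1 by omega, hδ', ← mul_prod_erase _ _ hi,
        ← mul_prod_erase _ _ hi, Pi.single_eq_same, mul_pow, mul_assoc]
      congr 1
      rw [← prod_pow, ← prod_mul_distrib]
      exact prod_congr rfl fun l hl => by
        rw [Pi.single_eq_of_ne (ne_of_mem_erase hl), add_zero, pow_succ]
  obtain ⟨s, hs, hst, hnk⟩ := hδt
  rw [← hn]
  rcases n with _ | n
  · simp
  · rw [mul_assoc X, coeff_succ_X_mul, coeff_mul, mul_sum]
    refine sum_mem fun p hp => ?_
    have hp' := mem_antidiagonal.1 hp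
    obtain ⟨z, hz, hzz⟩ := coeff_germ_mul_mem hN h0 hδ he (show p.1 ≤ k by omega)
    convert mul_mem (mul_mem hz hs) (hc p.2) using 1
    have : δ ^ (k - p.1) * δ ^ k = δ ^ (2 * k + 1 - (n + 1)) * δ ^ p.2 := by
      rw [← pow_add, ← pow_add]; congr 1; omega
    rw [hst] at this
    linear_combination δ ^ k * coeff p.2 (cofactor α ((fun _ => k) + Pi.single i 1) j) * hzz +
      z * coeff p.2 (cofactor α ((fun _ => k) + Pi.single i 1) j) * this

end Integrality

section Majorant

open PowerSeries Finset

/-- `c` bounds the sums of the absolute values of the terms of `f` at `X = 1 / 2`. -/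
def HalfBounded (c : ℝ) (f : ℝ⟦X⟧) : Prop :=
  ∀ n, ∑ m ∈ range n, |coeff m f| * (1 / 2) ^ m ≤ c

theorem HalfBounded.nonneg {c : ℝ} {f : ℝ⟦X⟧} (h : HalfBounded c f) : 0 ≤ c := by
  simpa using h 0

theorem HalfBounded.mono {c c' : ℝ} {f : ℝ⟦X⟧} (h : HalfBounded c f) (hc : c ≤ c') :
    HalfBounded c' f := fun n => (h n).trans hc

theorem HalfBounded.abs_coeff_le {c : ℝ} {f : ℝ⟦X⟧} (h : HalfBounded c f) (m : ℕ) :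
    |coeff m f| ≤ 2 ^ m * c := by
  have h1 := single_le_sum (f := fun m => |coeff m f| * (1 / 2 : ℝ) ^ m) (s := range (m + 1))
    (fun _ _ => by positivity) (mem_range.2 m.lt_succ_self)
  have h2 := h1.trans (h (m + 1))
  calc |coeff m f| = 2 ^ m * (|coeff m f| * (1 / 2) ^ m) := by
        rw [mul_left_comm, ← mul_pow]; norm_num
    _ ≤ 2 ^ m * c := by gcongr

theorem HalfBounded.mul {c c' : ℝ} {f g : ℝ⟦X⟧} (hf : HalfBounded c f) (hg : HalfBounded c' g) :
    HalfBounded (c * c') (f * g) := fun n => by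
  calc ∑ m ∈ range n, |coeff m (f * g)| * (1 / 2) ^ m
      ≤ ∑ m ∈ range n, ∑ p ∈ antidiagonal m,
          (|coeff p.1 f| * (1 / 2) ^ p.1) * (|coeff p.2 g| * (1 / 2) ^ p.2) := by
        refine sum_le_sum fun m _ => ?_
        rw [coeff_mul]
        refine (mul_le_mul_of_nonneg_right (abs_sum_le_sum_abs _ _) (by positivity)).trans_eq ?_
        rw [sum_mul]
        refine sum_congr rfl fun p hp => ?_
        rw [← mem_antidiagonal.1 hp, abs_mul, pow_add]
        ring
    _ = ∑ x ∈ (range n).sigma fun m => antidiagonal m,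
          (|coeff x.2.1 f| * (1 / 2) ^ x.2.1) * (|coeff x.2.2 g| * (1 / 2) ^ x.2.2) :=
        (sum_sigma (range n) (fun m => antidiagonal m) fun x =>
          (|coeff x.2.1 f| * (1 / 2) ^ x.2.1) * (|coeff x.2.2 g| * (1 / 2) ^ x.2.2)).symm
    _ ≤ ∑ p ∈ range n ×ˢ range n,
          (|coeff p.1 f| * (1 / 2) ^ p.1) * (|coeff p.2 g| * (1 / 2) ^ p.2) := by
        rw [← sum_image (g := fun x : (_ : ℕ) × (ℕ × ℕ) => x.2)
          (f := fun p => (|coeff p.1 f| * (1 / 2) ^ p.1) * (|coeff p.2 g| * (1 / 2) ^ p.2))]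
        · refine sum_le_sum_of_subset_of_nonneg ?_ fun _ _ _ => by positivity
          intro p hp
          obtain ⟨x, hx, rfl⟩ := mem_image.1 hp
          simp only [mem_sigma, mem_range, HasAntidiagonal.mem_antidiagonal] at hx
          simp only [mem_product, mem_range]
          omega
        · rintro ⟨m, p⟩ hx ⟨m', p'⟩ hx' h
          simp only [coe_sigma, Set.mem_sigma_iff, mem_coe,
            HasAntidiagonal.mem_antidiagonal] at hx hx'
          simp only at h
          subst h
          obtain rfl : m = m' := hx.2.symm.trans hx'.2
          rfl
    _ = (∑ m ∈ range n, |coeff m f| * (1 / 2) ^ m) * ∑ m ∈ range n, |coeff m g| * (1 / 2) ^ m := by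
        rw [sum_mul_sum, sum_product]
    _ ≤ c * c' := mul_le_mul (hf n) (hg n) (sum_nonneg fun _ _ => by positivity) hf.nonneg

theorem HalfBounded.of_abs_coeff_le {c r : ℝ} {f : ℝ⟦X⟧} (hc : 0 ≤ c) (hr : 0 ≤ r) (hr1 : r < 2)
    (h : ∀ m, |coeff m f| ≤ c * r ^ m) : HalfBounded (c / (1 - r / 2)) f := fun n => by
  have h1 : ∀ m, |coeff m f| * (1 / 2) ^ m ≤ c * (r / 2) ^ m := fun m => by
    refine (mul_le_mul_of_nonneg_right (h m) (by positivity)).trans_eq ?_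
    rw [mul_assoc, ← mul_pow, mul_one_div]
  have h2 : HasSum (fun m => c * (r / 2) ^ m) (c * (1 - r / 2)⁻¹) :=
    (hasSum_geometric_of_lt_one (by positivity) (by linarith)).mul_left c
  rw [div_eq_mul_inv]
  exact (sum_le_sum fun m _ => h1 m).trans
    (sum_le_hasSum _ (fun m _ => mul_nonneg hc (by positivity)) h2)

theorem HalfBounded.C_add_C_mul_X (a b : ℝ) : HalfBounded (|a| + |b| / 2) (C a + C b * X) :=
  fun n => by
    have h : ∀ m, m ≠ 0 → m ≠ 1 → |coeff m (C a + C b * X : ℝ⟦X⟧)| * (1 / 2 : ℝ) ^ m = 0 :=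
      fun m h0 h1 => by simp [coeff_C, coeff_X, h0, h1]
    calc ∑ m ∈ range n, |coeff m (C a + C b * X : ℝ⟦X⟧)| * (1 / 2 : ℝ) ^ m
        ≤ ∑ m ∈ range (n + 2), |coeff m (C a + C b * X : ℝ⟦X⟧)| * (1 / 2 : ℝ) ^ m :=
          sum_le_sum_of_subset_of_nonneg (range_mono (by omega)) fun _ _ _ => by positivity
      _ = |a| + |b| / 2 := by
          rw [add_comm, sum_range_add, sum_eq_zero (s := range n)]
          · simp [sum_range_succ, coeff_C, coeff_X]
            ring
          · intro m _
            exact h _ (by omega) (by omega)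
      _ ≤ _ := le_rfl

theorem HalfBounded.pow {c : ℝ} {f : ℝ⟦X⟧} (hf : HalfBounded c f) (n : ℕ) :
    HalfBounded (c ^ n) (f ^ n) := by
  induction n with
  | zero => simpa using HalfBounded.C_add_C_mul_X 1 0
  | succ n ih => rw [pow_succ, pow_succ]; exact ih.mul hf

theorem HalfBounded.prod {ι : Type*} {s : Finset ι} {c : ι → ℝ} {f : ι → ℝ⟦X⟧}
    (h : ∀ i ∈ s, HalfBounded (c i) (f i)) : HalfBounded (∏ i ∈ s, c i) (∏ i ∈ s, f i) := by
  classical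
  induction s using Finset.induction_on with
  | empty => simpa using HalfBounded.C_add_C_mul_X 1 0
  | insert a s ha ih =>
    rw [prod_insert ha, prod_insert ha]
    exact (h a (mem_insert_self a s)).mul (ih fun i hi => h i (mem_insert_of_mem hi))

theorem halfBounded_X_add_C_inv {d : ℝ} (hd : 1 ≤ |d|) :
    HalfBounded (1 / (|d| - 1 / 2)) (X + C d)⁻¹ := by
  have hd0 : d ≠ 0 := by rintro rfl; norm_num at hd
  have h := HalfBounded.of_abs_coeff_le (c := |d|⁻¹) (r := |d|⁻¹) (f := (X + C d)⁻¹)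
    (by positivity) (by positivity) ((inv_le_one_of_one_le₀ hd).trans_lt one_lt_two) fun m => by
      rw [coeff_X_add_C_inv hd0, abs_mul, abs_pow, abs_pow, abs_neg, abs_one, one_pow, one_mul,
        abs_inv, pow_succ']
  convert h using 1
  have : |d| ≠ 0 := by positivity
  field_simp

theorem halfBounded_germ {y a : ℝ} (h0 : 0 < 1 + a * y) (hy : 0 ≤ y) (h1 : y ≤ 1 + a * y) (k : ℕ) :
    HalfBounded (2 * (1 + a * y + y / 2) ^ k) (germ y k a) := by
  have hu : y / (1 + a * y) ≤ 1 := (div_le_one h0).2 h1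
  have e : germ y k a = (C (1 + a * y) + C y * X) ^ k *
      rescale (y / (1 + a * y)) (PowerSeries.binomialSeries ℝ (1 / 2 : ℝ)) := by
    rw [germ, PowerSeries.binomialSeries_add, PowerSeries.binomialSeries_nat, map_mul, ← mul_assoc,
      map_pow, map_pow, ← mul_pow]
    congr 2
    rw [map_add (rescale _), map_one (rescale _), rescale_X, mul_add, ← mul_assoc, ← map_mul,
      mul_div_cancel₀ _ h0.ne', mul_one]
  rw [e, mul_comm (2 : ℝ)]
  refine HalfBounded.mul (HalfBounded.pow ?_ k) ?_
  · refine (HalfBounded.C_add_C_mul_X _ _).mono ?_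
    rw [abs_of_pos h0, abs_of_nonneg hy]
  · have := HalfBounded.of_abs_coeff_le (c := 1) (r := 1)
      (f := rescale (y / (1 + a * y)) (PowerSeries.binomialSeries ℝ (1 / 2 : ℝ)))
      zero_le_one zero_le_one one_lt_two fun m => by
        rw [coeff_rescale, PowerSeries.binomialSeries_coeff, smul_eq_mul, mul_one, abs_mul, one_pow,
          one_mul, abs_pow, abs_of_nonneg (by positivity : 0 ≤ y / (1 + a * y))]
        exact mul_le_one₀ (pow_le_one₀ (by positivity) hu) (abs_nonneg _) (abs_choose_half_le_one m)
    convert this using 1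
    norm_num

variable {ι : Type*} [Fintype ι] [DecidableEq ι]

theorem halfBounded_cofactor {α : ι → ℝ} {j : ι} (h1 : ∀ l, l ≠ j → 1 ≤ |α j - α l|) {R : ℝ}
    (hR : ∏ l ∈ univ.erase j, 1 / (|α j - α l| - 1 / 2) ≤ R) (k : ℕ) (i : ι) :
    HalfBounded (2 * R ^ k) (cofactor α ((fun _ => k) + Pi.single i 1) j) := by
  have hb : ∀ l ∈ univ.erase j, HalfBounded ((1 / (|α j - α l| - 1 / 2)) ^
      ((fun _ => k) + Pi.single i 1 : ι → ℕ) l)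
      ((X + C (α j - α l))⁻¹ ^ ((fun _ => k) + Pi.single i 1 : ι → ℕ) l) := fun l hl =>
    (halfBounded_X_add_C_inv (h1 l (ne_of_mem_erase hl))).pow _
  refine (HalfBounded.prod hb).mono ?_
  have hpos : ∀ l ∈ univ.erase j, 0 ≤ 1 / (|α j - α l| - 1 / 2) := fun l hl =>
    (halfBounded_X_add_C_inv (h1 l (ne_of_mem_erase hl))).nonneg
  simp only [Pi.add_apply, pow_add, prod_mul_distrib, prod_pow]
  rw [mul_comm]
  refine mul_le_mul ?_ (pow_le_pow_left₀ (prod_nonneg hpos) hR k) (by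
    exact pow_nonneg (prod_nonneg hpos) k) two_pos.le
  by_cases h : i ∈ univ.erase j
  · rw [prod_eq_single_of_mem i h fun l _ hl => by rw [Pi.single_eq_of_ne hl, pow_zero],
      Pi.single_eq_same, pow_one]
    have := h1 i (ne_of_mem_erase h)
    rw [div_le_iff₀ (by linarith)]
    linarith
  · have h2 : ∀ l ∈ univ.erase j, l ≠ i := fun l hl e => h (e ▸ hl)
    rw [prod_eq_one fun l hl => by rw [Pi.single_eq_of_ne (h2 l hl), pow_zero]]
    exact one_le_two

theorem abs_coeff_germ_mul_cofactor_le {α : ι → ℝ} {j : ι} (h1 : ∀ l, l ≠ j → 1 ≤ |α j - α l|)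
    {R y : ℝ} (hR : ∏ l ∈ univ.erase j, 1 / (|α j - α l| - 1 / 2) ≤ R) (h0 : 0 < 1 + α j * y)
    (hy : 0 ≤ y) (hya : y ≤ 1 + α j * y) (k : ℕ) (i : ι) :
    |coeff (((fun _ => k) + Pi.single i 1 : ι → ℕ) j)
      (X * germ y k (α j) * cofactor α ((fun _ => k) + Pi.single i 1) j)| ≤
      4 * (2 * (1 + α j * y + y / 2) * R) ^ k := by
  have h := (halfBounded_germ h0 hy hya k).mul (halfBounded_cofactor h1 hR k i)
  obtain ⟨n, hn⟩ : ∃ n, n = ((fun _ => k) + Pi.single i 1 : ι → ℕ) j := ⟨_, rfl⟩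
  have hnk : n ≤ k + 1 := by
    rw [hn, Pi.add_apply, Pi.single_apply]
    split_ifs <;> omega
  rw [← hn]
  have e : 2 ^ k * (2 * (1 + α j * y + y / 2) ^ k * (2 * R ^ k)) =
      4 * (2 * (1 + α j * y + y / 2) * R) ^ k := by
    rw [mul_pow, mul_pow]; ring
  rcases n with _ | n
  · rw [mul_assoc, coeff_zero_X_mul, abs_zero, ← e]
    exact mul_nonneg (by positivity) h.nonneg
  · rw [mul_assoc, coeff_succ_X_mul]
    refine (h.abs_coeff_le n).trans ?_
    rw [← e]
    exact mul_le_mul_of_nonneg_right (pow_le_pow_right₀ one_le_two (by omega)) h.nonneg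

end Majorant

section Approximation

open PowerSeries Finset

variable {ι : Type*} [Fintype ι] [DecidableEq ι]

theorem resSum_C_mul_germ_eq_sum (α : ι → ℝ) (k : ι → ℕ) (p : ι → ℝ) (G : ι → ℝ⟦X⟧) :
    resSum α k (fun j => C (p j) * G j) =
      ∑ j, p j * coeff (k j) (X * G j * cofactor α k j) := by
  refine sum_congr rfl fun j _ => ?_
  rw [← coeff_C_mul]
  congr 1
  ring

theorem exists_resSum_germ_ne_zero (hι : Fintype.card ι = 3) {α : ι → ℝ}
    (hα : Function.Injective α) {y : ℝ} (hy : y ≠ 0) (h0 : ∀ j, 1 + α j * y ≠ 0) (k : ℕ)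
    {p : ι → ℝ} (hp : p ≠ 0) :
    ∃ i, resSum α ((fun _ => k) + Pi.single i 1) (fun j => C (p j) * germ y k (α j)) ≠ 0 := by
  by_contra! h
  refine hp (funext fun j => ?_)
  have := constantCoeff_eq_zero_of_resSum_eq_zero hα (y := y) (κ := (k : ℝ) + 1 / 2) (k := k)
    (G := fun j => C (p j) * germ y k (α j)) (fun j => ?_) (fun n => ?_) h j
  · rw [map_mul, constantCoeff_C, ← coeff_zero_eq_constantCoeff_apply, coeff_germ] at this
    simpa [h0 j] using this
  · have hD : derivative ℝ (C (p j) : ℝ⟦X⟧) = 0 := by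
      ext m
      simp
    rw [Derivation.leibniz, hD, smul_zero, add_zero, smul_eq_mul]
    linear_combination C (p j) * germ_ode (h0 j) k
  · refine mul_ne_zero hy fun e => ?_
    rw [hι] at e
    have : ((2 * n + 3 : ℕ) : ℝ) = ((4 * k : ℕ) : ℝ) := by push_cast at e ⊢; linarith
    have := Nat.cast_injective this
    omega

theorem one_le_of_approx (hι : Fintype.card ι = 3) {α : ι → ℝ} (hα : Function.Injective α)
    (hint : ∀ i j, α i - α j ∈ (Int.castRingHom ℝ).range) {N L M U V : ℝ} {R : ι → ℝ}
    (hN : 0 < N) (hL : 0 < L) (hpos : ∀ j, 4 ≤ N + 4 * α j)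
    (he : ∀ j, ∃ e ∈ (Int.castRingHom ℝ).range,
      N + 4 * α j = (∏ l ∈ univ.erase j, (α j - α l)) * e)
    (ht : ∀ j, ∃ t ∈ (Int.castRingHom ℝ).range, L = (∏ l ∈ univ.erase j, (α j - α l)) * t)
    (h1 : ∀ j l, l ≠ j → 1 ≤ |α j - α l|)
    (hR : ∀ j, ∏ l ∈ univ.erase j, 1 / (|α j - α l| - 1 / 2) ≤ R j)
    (hM : ∀ j, |α j| ≤ M) (hMN : 4 * M < N)
    (hU : ∀ j, 2 * L * (N + 4 * α j + 2) * R j ≤ U) (hV : 0 < V)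
    (hVM : 64 * L * V ≤ 6 * (N - 4 * M) ^ 2) {k : ℕ} (hk : 0 < k)
    {p : ι → ℤ} (hp : p ≠ 0) {q : ℝ} (hq : 0 ≤ q) :
    1 ≤ 4 * U ^ k * ∑ j, |p j - q * √(1 + α j * (4 / N))| + q / V ^ k := by
  have hy : (0 : ℝ) < 4 / N := by positivity
  have e1 : ∀ j, 1 + α j * (4 / N) = (N + 4 * α j) / N := fun j => by field_simp
  have hpos' : ∀ j, 0 < 1 + α j * (4 / N) := fun j => by
    rw [e1]; exact div_pos (by linarith [hpos j]) hN
  obtain ⟨i, hi⟩ := exists_resSum_germ_ne_zero hι hα hy.ne' (fun j => (hpos' j).ne') k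
    (p := fun j => (p j : ℝ)) (fun h => hp (funext fun j => by
      have := congrFun h j
      simpa using this))
  set K : ι → ℕ := (fun _ => k) + Pi.single i 1 with hK
  set P : ι → ℝ := fun j => coeff (K j) (X * germ (4 / N) k (α j) * cofactor α K j) with hP
  rw [resSum_C_mul_germ_eq_sum] at hi
  have hDpos : (0 : ℝ) < N ^ k * L ^ k := by positivity
  have hint1 : (N ^ k * L ^ k) * ∑ j, (p j : ℝ) * P j ∈ (Int.castRingHom ℝ).range := by
    rw [mul_sum]
    refine sum_mem fun j _ => ?_
    obtain ⟨e, he, hee⟩ := he j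
    obtain ⟨t, ht, htt⟩ := ht j
    have := coeff_germ_mul_cofactor_mem hα hint hN.ne' (by linarith [hpos j]) hee he k i
    convert mul_mem (mul_mem (pow_mem ht k) this)
      (show (p j : ℝ) ∈ (Int.castRingHom ℝ).range from ⟨p j, rfl⟩) using 1
    nth_rw 1 [htt]
    rw [mul_pow, hP, hK]
    ring
  have hge : 1 ≤ (N ^ k * L ^ k) * |∑ j, (p j : ℝ) * P j| := by
    obtain ⟨z, hz⟩ := hint1
    rw [← abs_of_pos hDpos, ← abs_mul, ← hz]
    have : z ≠ 0 := by
      rintro rfl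
      rw [map_zero] at hz
      exact mul_ne_zero hDpos.ne' hi hz.symm
    rw [eq_intCast]
    exact_mod_cast Int.one_le_abs this
  have hPle : ∀ j, (N ^ k * L ^ k) * |P j| ≤ 4 * U ^ k := fun j => by
    have hb := abs_coeff_germ_mul_cofactor_le (h1 j) (hR j) (hpos' j) hy.le (by
      rw [e1]; exact div_le_div_of_nonneg_right (hpos j) hN.le) k i
    have hR0 : 0 ≤ R j := (prod_nonneg fun l hl => by
      have := h1 j l (ne_of_mem_erase hl)
      exact one_div_nonneg.2 (by linarith)).trans (hR j)
    refine (mul_le_mul_of_nonneg_left hb hDpos.le).trans ?_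
    rw [mul_left_comm, ← mul_pow, ← mul_pow]
    have e2 : N * L * (2 * (1 + α j * (4 / N) + 4 / N / 2) * R j) =
        2 * L * (N + 4 * α j + 2) * R j := by field_simp; ring
    rw [e2]
    have h4 : 0 ≤ 2 * L * (N + 4 * α j + 2) * R j :=
      mul_nonneg (mul_nonneg (by positivity) (by linarith [hpos j])) hR0
    exact mul_le_mul_of_nonneg_left (pow_le_pow_left₀ h4 (hU j) k) (by norm_num)
  have hI : (N ^ k * L ^ k) * |∑ j, √(1 + α j * (4 / N)) * P j| ≤ 1 / V ^ k := by
    obtain ⟨j₀⟩ : Nonempty ι := Fintype.card_pos_iff.1 (by omega)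
    have hM0 : 0 ≤ M := (abs_nonneg _).trans (hM j₀)
    have hMy : M * (4 / N) < 1 := by
      rw [mul_div_assoc', div_lt_one hN]; linarith
    have hk1 : (1 : ℝ) ≤ k := by exact_mod_cast hk
    have h := abs_resSum_germ_le hα hy.le hM0 hM hMy (k := K) (n := 3 * k) (r := k) (by
      simp [hK, sum_add_distrib, hι]) (by push_cast; linarith)
    rw [resSum_C_mul_germ_eq_sum] at h
    have hx0 : 0 < 1 - M * (4 / N) := by linarith
    have hx1 : 1 - M * (4 / N) ≤ 1 := by linarith [mul_nonneg hM0 hy.le]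
    have h2 : (1 - M * (4 / N)) ^ ((k : ℝ) + 1 / 2 - (3 * k : ℕ)) ≤
        ((1 - M * (4 / N)) ^ 2)⁻¹ ^ k := by
      rw [← inv_pow, ← pow_mul, inv_pow, ← Real.rpow_natCast, ← Real.rpow_neg hx0.le]
      refine Real.rpow_le_rpow_of_exponent_ge hx0 hx1 ?_
      push_cast
      linarith
    have h3 : |Ring.choose ((k : ℝ) + 1 / 2) (3 * k)| ≤ (1 / 6) ^ k := by
      rw [one_div_pow, le_div_iff₀ (by positivity), mul_comm]
      exact six_pow_mul_abs_choose_le_one k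
    have h4 : |∑ j, √(1 + α j * (4 / N)) * P j| ≤
        (1 / 6 * (4 / N) ^ 3 * ((1 - M * (4 / N)) ^ 2)⁻¹) ^ k := by
      refine h.trans ?_
      rw [mul_pow, mul_pow, ← pow_mul]
      gcongr
    refine (mul_le_mul_of_nonneg_left h4 hDpos.le).trans ?_
    rw [← one_div_pow, ← mul_pow, ← mul_pow]
    have hs : 0 < N - 4 * M := by linarith
    have e2 : 1 - M * (4 / N) = (N - 4 * M) / N := by field_simp
    refine pow_le_pow_left₀ (by positivity) ?_ k
    rw [le_div_iff₀ hV, e2]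
    have e3 : N * L * (1 / 6 * (4 / N) ^ 3 * (((N - 4 * M) / N) ^ 2)⁻¹) * V =
        64 * L * V / (6 * (N - 4 * M) ^ 2) := by
      field_simp
      ring
    rw [e3]
    exact (div_le_one (by positivity)).2 hVM
  have hsplit : ∑ j, (p j : ℝ) * P j = ∑ j, (p j - q * √(1 + α j * (4 / N))) * P j +
      q * ∑ j, √(1 + α j * (4 / N)) * P j := by
    rw [mul_sum, ← sum_add_distrib]
    exact sum_congr rfl fun j _ => by ring
  calc (1 : ℝ) ≤ (N ^ k * L ^ k) * |∑ j, (p j : ℝ) * P j| := hge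
    _ ≤ (N ^ k * L ^ k) * (∑ j, |p j - q * √(1 + α j * (4 / N))| * |P j| +
          q * |∑ j, √(1 + α j * (4 / N)) * P j|) := by
        refine mul_le_mul_of_nonneg_left ?_ hDpos.le
        rw [hsplit]
        refine (abs_add_le _ _).trans (add_le_add ?_ (by rw [abs_mul, abs_of_nonneg hq]))
        refine (abs_sum_le_sum_abs _ _).trans_eq (sum_congr rfl fun j _ => abs_mul _ _)
    _ = ∑ j, |p j - q * √(1 + α j * (4 / N))| * ((N ^ k * L ^ k) * |P j|) +
          q * ((N ^ k * L ^ k) * |∑ j, √(1 + α j * (4 / N)) * P j|) := by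
        rw [mul_add, mul_sum]
        congr 1
        · exact sum_congr rfl fun j _ => by ring
        · ring
    _ ≤ ∑ j, |p j - q * √(1 + α j * (4 / N))| * (4 * U ^ k) + q * (1 / V ^ k) :=
        add_le_add (sum_le_sum fun j _ => mul_le_mul_of_nonneg_left (hPle j) (abs_nonneg _))
          (mul_le_mul_of_nonneg_left hI hq)
    _ = _ := by rw [← sum_mul]; ring

end Approximation

section Triple

open Finset

theorem prod_erase_fin_three {M : Type*} [CommMonoid M] (f : Fin 3 → M) :
    ∏ l ∈ univ.erase 0, f l = f 1 * f 2 ∧ ∏ l ∈ univ.erase 1, f l = f 0 * f 2 ∧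
      ∏ l ∈ univ.erase 2, f l = f 0 * f 1 := by
  have h0 : (univ.erase 0 : Finset (Fin 3)) = {1, 2} := by decide
  have h1 : (univ.erase 1 : Finset (Fin 3)) = {0, 2} := by decide
  have h2 : (univ.erase 2 : Finset (Fin 3)) = {0, 1} := by decide
  rw [h0, h1, h2]
  exact ⟨prod_pair (by decide), prod_pair (by decide), prod_pair (by decide)⟩

theorem one_le_of_approx_triple {A K σ : ℤ} (hA : 2 ≤ A) (hK : 23000 ≤ K)
    (hσ : σ = 1 ∨ σ = -1) {k : ℕ} (hk : 0 < k) {p₀ p₁ p₂ : ℤ} (hp : p₀ ≠ 0) {q : ℝ} (hq : 0 ≤ q) :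
    1 ≤ 4 * (4.004 * (A * (A + 1)) ^ 2 * K / (A - 1 / 2)) ^ k *
      (|p₀ - q| + |p₁ - q * √(1 + 4 * σ / ((A + 1) * K))| +
        |p₂ - q * √(1 + 4 * σ / (A * K))|) + q / (0.0936 * (A * (A + 1)) * K ^ 2) ^ k := by
  have hA' : (2 : ℝ) ≤ A := by exact_mod_cast hA
  have hK' : (23000 : ℝ) ≤ K := by exact_mod_cast hK
  have hσ2 : (σ : ℝ) * σ = 1 := by rcases hσ with rfl | rfl <;> norm_num
  have hσl : (-1 : ℝ) ≤ σ := by rcases hσ with rfl | rfl <;> norm_num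
  have hσu : (σ : ℝ) ≤ 1 := by rcases hσ with rfl | rfl <;> norm_num
  have hσa : |(σ : ℝ)| = 1 := by rcases hσ with rfl | rfl <;> norm_num
  have hAK : (46000 : ℝ) ≤ A * K := by nlinarith
  have hmem : ∀ z : ℤ, (z : ℝ) ∈ (Int.castRingHom ℝ).range := fun z => ⟨z, rfl⟩
  set α : Fin 3 → ℝ := ![0, σ * A, σ * (A + 1)] with hα
  have α0 : α 0 = 0 := rfl
  have α1 : α 1 = σ * A := rfl
  have α2 : α 2 = σ * (A + 1) := rfl
  have a1 : |(σ : ℝ) * A| = A := by rw [abs_mul, hσa, one_mul, abs_of_nonneg (by linarith)]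
  have a2 : |(σ : ℝ) * (A + 1)| = A + 1 := by
    rw [abs_mul, hσa, one_mul, abs_of_nonneg (by linarith)]
  have a3 : |(σ : ℝ) * A - σ * (A + 1)| = 1 := by
    rw [show (σ : ℝ) * A - σ * (A + 1) = -σ by ring, abs_neg, hσa]
  have d01 : |α 0 - α 1| = A := by rw [α0, α1, zero_sub, abs_neg, a1]
  have d02 : |α 0 - α 2| = A + 1 := by rw [α0, α2, zero_sub, abs_neg, a2]
  have d12 : |α 1 - α 2| = 1 := by rw [α1, α2, a3]
  have d10 : |α 1 - α 0| = A := by rw [abs_sub_comm, d01]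
  have d20 : |α 2 - α 0| = A + 1 := by rw [abs_sub_comm, d02]
  have d21 : |α 2 - α 1| = 1 := by rw [abs_sub_comm, d12]
  have h1 : ∀ j l, l ≠ j → 1 ≤ |α j - α l| := by
    intro j l h
    fin_cases j <;> fin_cases l <;> simp only [Fin.zero_eta, Fin.mk_one, Fin.reduceFinMk] at h ⊢ <;>
      first | exact absurd rfl h | linarith
  have hN : (0 : ℝ) < A * (A + 1) * K := by positivity
  have hs : (1 : ℝ) / 2 < A := by linarith
  have hNA : 46000 * (A + 1 : ℝ) ≤ A * (A + 1) * K := by nlinarith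
  have hnum : ∀ t : ℝ, t ≤ 4 * (A + 1) → 2 * (A * (A + 1)) * (A * (A + 1) * K + t + 2) *
      (2 / (A - 1 / 2)) ≤ 4.004 * (A * (A + 1)) ^ 2 * K / (A - 1 / 2) := fun t ht => by
    rw [mul_div_assoc', div_le_div_iff_of_pos_right (by linarith)]
    have : 4 * (A * (A + 1) * K + t + 2) ≤ 4.004 * (A * (A + 1) * K : ℝ) := by linarith
    have h3 : (0 : ℝ) ≤ A * (A + 1) := by positivity
    linear_combination (A * (A + 1) : ℝ) * this
  have hR : ∀ s x : ℝ, A ≤ s → 1 ≤ x →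
      1 / (s - 1 / 2) * (1 / (x - 1 / 2)) ≤ 2 / (A - 1 / 2) := fun s x hs' hx => by
    have i1 : 1 / (s - 1 / 2) ≤ 1 / ((A : ℝ) - 1 / 2) :=
      one_div_le_one_div_of_le (by linarith) (by linarith)
    have i2 : 1 / (x - 1 / 2) ≤ 2 := by rw [div_le_iff₀ (by linarith)]; linarith
    refine (mul_le_mul i1 i2 (one_div_nonneg.2 (by linarith))
      (one_div_nonneg.2 (by linarith))).trans_eq ?_
    ring
  have hsq : ∀ x : ℝ, 46000 ≤ x → 0.9984 * x ^ 2 ≤ (x - 4) ^ 2 := fun x hx => by nlinarith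
  have l1 := neg_abs_le ((σ : ℝ) * A)
  have l2 := neg_abs_le ((σ : ℝ) * (A + 1))
  have u1 := le_abs_self ((σ : ℝ) * A)
  have u2 := le_abs_self ((σ : ℝ) * (A + 1))
  rw [a1] at l1 u1
  rw [a2] at l2 u2
  have main := one_le_of_approx (ι := Fin 3) (by simp) (α := α) (fun j l h => by
      by_contra hne
      have := h1 j l (Ne.symm hne)
      rw [h, sub_self, abs_zero] at this
      linarith) (fun i j => by
      have hm : ∀ j, α j ∈ (Int.castRingHom ℝ).range := fun j => by
        fin_cases j
        · exact zero_mem _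
        · exact mul_mem (hmem _) (hmem _)
        · exact mul_mem (hmem _) (add_mem (hmem _) (one_mem _))
      exact sub_mem (hm i) (hm j))
    (N := A * (A + 1) * K) (L := A * (A + 1)) (M := A + 1)
    (U := 4.004 * (A * (A + 1)) ^ 2 * K / (A - 1 / 2)) (V := 0.0936 * (A * (A + 1)) * K ^ 2)
    (R := fun _ => 2 / (A - 1 / 2)) hN (by positivity) (fun j => by
      fin_cases j <;> simp only [Fin.zero_eta, Fin.mk_one, Fin.reduceFinMk, α0, α1, α2] <;>
        linarith) (fun j => by
      fin_cases j <;> simp only [Fin.zero_eta, Fin.mk_one, Fin.reduceFinMk, prod_erase_fin_three]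
      · refine ⟨K, hmem K, ?_⟩
        rw [α0, α1, α2]
        linear_combination -(A * (A + 1) * K : ℝ) * hσ2
      · refine ⟨-((A + 1) * K + 4 * σ), by
          exact_mod_cast hmem (-((A + 1) * K + 4 * σ)), ?_⟩
        rw [α0, α1, α2]
        linear_combination -(A * ((A + 1) * K + 4 * σ) : ℝ) * hσ2
      · refine ⟨A * K + 4 * σ, by exact_mod_cast hmem (A * K + 4 * σ), ?_⟩
        rw [α0, α1, α2]
        linear_combination -((A + 1) * (A * K + 4 * σ) : ℝ) * hσ2) (fun j => by
      fin_cases j <;> simp only [Fin.zero_eta, Fin.mk_one, Fin.reduceFinMk, prod_erase_fin_three]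
      · refine ⟨1, one_mem _, ?_⟩
        rw [α0, α1, α2]
        linear_combination -(A * (A + 1) : ℝ) * hσ2
      · refine ⟨-(A + 1), by exact_mod_cast hmem (-(A + 1)), ?_⟩
        rw [α0, α1, α2]
        linear_combination -(A * (A + 1) : ℝ) * hσ2
      · refine ⟨A, hmem A, ?_⟩
        rw [α0, α1, α2]
        linear_combination -(A * (A + 1) : ℝ) * hσ2) h1 (fun j => by
      fin_cases j <;> simp only [Fin.zero_eta, Fin.mk_one, Fin.reduceFinMk, prod_erase_fin_three,
        d01, d02, d12, d10, d20, d21]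
      · exact hR _ _ le_rfl (by linarith)
      · exact hR _ _ le_rfl le_rfl
      · exact hR _ _ (by linarith) le_rfl) (fun j => by
      fin_cases j <;> simp only [Fin.zero_eta, Fin.mk_one, Fin.reduceFinMk, α0, α1, α2, a1, a2,
        abs_zero] <;> linarith) (by linarith) (fun j => by
      refine hnum _ ?_
      fin_cases j <;> simp only [Fin.zero_eta, Fin.mk_one, Fin.reduceFinMk, α0, α1, α2] <;>
        linarith) (by positivity) (by
      have h3 := mul_le_mul_of_nonneg_left (hsq _ hAK) (by positivity : (0 : ℝ) ≤ 6 * (A + 1) ^ 2)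
      linear_combination h3) hk (p := ![p₀, p₁, p₂]) (fun h => hp (congrFun h 0)) hq
  rw [Fin.sum_univ_three] at main
  have e1 : 1 + α 1 * (4 / (A * (A + 1) * K)) = 1 + 4 * σ / ((A + 1) * K) := by
    rw [α1]; field_simp
  have e2 : 1 + α 2 * (4 / (A * (A + 1) * K)) = 1 + 4 * σ / (A * K) := by
    rw [α2]; field_simp
  rw [e1, e2, α0, zero_mul, add_zero, Real.sqrt_one, mul_one] at main
  exact main

end Triple

section Contradiction

theorem succ_pow_sixteen_le_two_pow {n : ℕ} (hn : 150 ≤ n) : (n + 1) ^ 16 ≤ 2 ^ (n - 3) := by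
  induction n, hn using Nat.le_induction with
  | base => norm_num
  | succ n hn ih =>
    have h3 : (n + 1 + 1) ^ 16 ≤ 2 * (n + 1) ^ 16 := by
      have h := Nat.pow_le_pow_left (show 100 * (n + 1 + 1) ≤ 101 * (n + 1) by omega) 16
      rw [mul_pow, mul_pow] at h
      generalize (n + 1 + 1) ^ 16 = x at h ⊢
      generalize (n + 1) ^ 16 = y at h ⊢
      norm_num at h
      omega
    rw [show n + 1 - 3 = n - 3 + 1 by omega, pow_succ 2]
    generalize (n + 1 + 1) ^ 16 = x at h3 ⊢
    generalize (n + 1) ^ 16 = y at h3 ih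
    omega

theorem abs_sub_mul_sqrt_le {X Y K B d : ℝ} (hX : 0 < X) (hY : 0 < Y) (hK : 0 < K) (hB : K ≤ B)
    (h1 : X ^ 2 = K * d + 4) (h2 : Y ^ 2 = B * d + 4) :
    |Y - X * √(B / K)| ≤ 4 * √(B / K) / X := by
  have hg : 0 < B / K := div_pos (hK.trans_le hB) hK
  have hs := Real.sq_sqrt hg.le
  have hs0 := Real.sqrt_pos.2 hg
  have hd : (Y - X * √(B / K)) * (Y + X * √(B / K)) = 4 - 4 * (B / K) := by
    have h3 : X ^ 2 * (B / K) = B * d + 4 * (B / K) := by rw [h1]; field_simp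
    linear_combination h2 - h3 - X ^ 2 * hs
  have h1B : 1 ≤ B / K := (one_le_div hK).2 hB
  rw [le_div_iff₀ hX]
  refine le_of_mul_le_mul_right ?_ hs0
  calc |Y - X * √(B / K)| * X * √(B / K) ≤ |Y - X * √(B / K)| * (Y + X * √(B / K)) := by
        rw [mul_assoc]
        exact mul_le_mul_of_nonneg_left (by linarith) (abs_nonneg _)
    _ = |4 - 4 * (B / K)| := by
        rw [← hd, abs_mul, abs_of_pos (a := Y + X * √(B / K)) (by positivity)]
    _ ≤ 4 * √(B / K) * √(B / K) := by
        rw [abs_of_nonpos (by linarith)]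
        linarith

variable {A K σ : ℤ}

theorem one_le_of_pell {X Y Z d : ℤ} (hA : 2 ≤ A) (hK : 23000 ≤ K) (hσ : σ = 1 ∨ σ = -1)
    (hX : 0 < X) (hY : 0 < Y) (hZ : 0 < Z) (h1 : X ^ 2 = K * d + 4)
    (h2 : Y ^ 2 = (A ^ 2 * K + 4 * σ * A) * d + 4)
    (h3 : Z ^ 2 = ((A + 1) ^ 2 * K + 4 * σ * (A + 1)) * d + 4) {k : ℕ} (hk : 0 < k) :
    1 ≤ 32 * (A + 2) ^ 2 * (4.004 * (A * (A + 1)) ^ 2 * K / (A - 1 / 2) : ℝ) ^ k / X +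
      A * (A + 1) * X / (0.0936 * (A * (A + 1)) * K ^ 2 : ℝ) ^ k := by
  have hA' : (2 : ℝ) ≤ A := by exact_mod_cast hA
  have hK' : (23000 : ℝ) ≤ K := by exact_mod_cast hK
  have hX' : (0 : ℝ) < X := by exact_mod_cast hX
  have hY' : (0 : ℝ) < Y := by exact_mod_cast hY
  have hZ' : (0 : ℝ) < Z := by exact_mod_cast hZ
  have h1' : (X : ℝ) ^ 2 = K * d + 4 := by exact_mod_cast h1
  have h2' : (Y : ℝ) ^ 2 = (A ^ 2 * K + 4 * σ * A) * d + 4 := by exact_mod_cast h2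
  have h3' : (Z : ℝ) ^ 2 = ((A + 1) ^ 2 * K + 4 * σ * (A + 1)) * d + 4 := by exact_mod_cast h3
  have hσl : (-1 : ℝ) ≤ σ := by rcases hσ with rfl | rfl <;> norm_num
  have hσu : (σ : ℝ) ≤ 1 := by rcases hσ with rfl | rfl <;> norm_num
  have hK0 : (0 : ℝ) < K := by linarith
  have bound : ∀ t : ℝ, 2 ≤ t → t ≤ A + 1 → K ≤ t ^ 2 * K + 4 * σ * t ∧
      √((t ^ 2 * K + 4 * σ * t) / K) = t * √(1 + 4 * σ / (t * K)) ∧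
      √((t ^ 2 * K + 4 * σ * t) / K) ≤ t + 1 := fun t ht _ => by
    have e : (t ^ 2 * K + 4 * σ * t) / K = t ^ 2 * (1 + 4 * σ / (t * K)) := by field_simp
    have hσt : -t ≤ σ * t := by nlinarith
    have h4 : 3 * (K : ℝ) ≤ (t ^ 2 - 1) * K :=
      mul_le_mul_of_nonneg_right (by nlinarith) hK0.le
    have h5 : t * K ≤ (t ^ 2 - 1) * K := mul_le_mul_of_nonneg_right (by nlinarith) hK0.le
    refine ⟨by nlinarith, ?_, ?_⟩
    · rw [e, Real.sqrt_mul (sq_nonneg t), Real.sqrt_sq (by linarith)]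
    · rw [Real.sqrt_le_left (by linarith), div_le_iff₀ hK0]
      nlinarith
  obtain ⟨b1, b2, b3⟩ := bound A hA' (by linarith)
  obtain ⟨c1, c2, c3⟩ := bound (A + 1) (by linarith) le_rfl
  have hYb := abs_sub_mul_sqrt_le hX' hY' hK0 b1 h1' h2'
  have hZb := abs_sub_mul_sqrt_le hX' hZ' hK0 c1 h1' h3'
  have hYc : |((A + 1) * Y : ℤ) - (A * (A + 1) * X : ℝ) * √(1 + 4 * σ / (A * K))| ≤
      4 * (A + 2) ^ 2 / X := by
    have e : ((A + 1) * Y : ℤ) - (A * (A + 1) * X : ℝ) * √(1 + 4 * σ / (A * K)) =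
        (A + 1) * (Y - X * √((A ^ 2 * K + 4 * σ * A) / K)) := by
      rw [b2]; push_cast; ring
    rw [e, abs_mul, abs_of_nonneg (a := (A + 1 : ℝ)) (by linarith)]
    refine (mul_le_mul_of_nonneg_left hYb (by linarith)).trans ?_
    rw [mul_div_assoc', div_le_div_iff_of_pos_right hX']
    nlinarith
  have hZc : |(A * Z : ℤ) - (A * (A + 1) * X : ℝ) * √(1 + 4 * σ / ((A + 1) * K))| ≤
      4 * (A + 2) ^ 2 / X := by
    have e : (A * Z : ℤ) - (A * (A + 1) * X : ℝ) * √(1 + 4 * σ / ((A + 1) * K)) =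
        A * (Z - X * √(((A + 1) ^ 2 * K + 4 * σ * (A + 1)) / K)) := by
      rw [c2]; push_cast; ring
    rw [e, abs_mul, abs_of_nonneg (a := (A : ℝ)) (by linarith)]
    refine (mul_le_mul_of_nonneg_left hZb (by linarith)).trans ?_
    rw [mul_div_assoc', div_le_div_iff_of_pos_right hX']
    nlinarith
  have hU : (0 : ℝ) ≤ 4.004 * (A * (A + 1)) ^ 2 * K / (A - 1 / 2) :=
    div_nonneg (by positivity) (by linarith)
  have main := one_le_of_approx_triple hA hK hσ hk (p₀ := A * (A + 1) * X) (p₁ := A * Z)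
    (p₂ := (A + 1) * Y) (by positivity) (q := A * (A + 1) * X) (by positivity)
  rw [show ((A * (A + 1) * X : ℤ) : ℝ) - A * (A + 1) * X = 0 by push_cast; ring, abs_zero] at main
  refine main.trans (add_le_add_left ?_ _)
  refine (mul_le_mul_of_nonneg_left (add_le_add (add_le_add_right hZc 0) hYc)
    (by positivity)).trans_eq ?_
  ring

theorem bounds_of_le {A K : ℝ} (hA : 2 ≤ A) (hK : 23000 ≤ K) (hKA : 240 * (A + 1) ≤ K) :
    4 * (4.004 * (A * (A + 1)) ^ 2 * K / (A - 1 / 2)) ≤ 0.0936 * (A * (A + 1)) * K ^ 2 ∧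
    128 * (A * (A + 1)) * (A + 2) ^ 2 * (4.004 * (A * (A + 1)) ^ 2 * K / (A - 1 / 2)) ≤ K ^ 8 ∧
    0.0936 * (A * (A + 1)) * K ^ 2 ≤ (A * K) ^ 2 := by
  have hA0 : 0 < A - 1 / 2 := by linarith
  refine ⟨?_, ?_, ?_⟩
  · rw [mul_div_assoc', div_le_iff₀ hA0]
    have h1 : (A - 1 / 2) * (240 * (A + 1)) ≤ (A - 1 / 2) * K :=
      mul_le_mul_of_nonneg_left hKA hA0.le
    have h2 : 3 / 4 * A * (A + 1) ≤ (A - 1 / 2) * (A + 1) :=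
      mul_le_mul_of_nonneg_right (by linarith) (by linarith)
    have h3 : 16.016 * (A * (A + 1)) ≤ 0.0936 * K * (A - 1 / 2) := by
      have : 0 ≤ A * (A + 1) := by positivity
      linarith
    have h4 := mul_le_mul_of_nonneg_left h3 (by positivity : 0 ≤ A * (A + 1) * K)
    linear_combination h4
  · have h1 : 4.004 * (A * (A + 1)) ^ 2 * K / (A - 1 / 2) ≤ 8.008 * (A * (A + 1) ^ 2) * K := by
      rw [div_le_iff₀ hA0]
      have h2 := mul_le_mul_of_nonneg_left (show A ≤ 2 * (A - 1 / 2) by linarith)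
        (by positivity : 0 ≤ 4.004 * (A * (A + 1) ^ 2) * K)
      linear_combination h2
    have h2 : A + 2 ≤ K / 100 := by linarith
    calc 128 * (A * (A + 1)) * (A + 2) ^ 2 * (4.004 * (A * (A + 1)) ^ 2 * K / (A - 1 / 2))
        ≤ 128 * ((K / 100) * (K / 100)) * (K / 100) ^ 2 *
            (8.008 * ((K / 100) * (K / 100) ^ 2) * K) := by
          refine mul_le_mul ?_ (h1.trans ?_) (div_nonneg (by positivity) hA0.le) (by positivity)
          · gcongr <;> linarith
          · gcongr <;> linarith
      _ = 128 * 8.008 / 10 ^ 14 * K ^ 8 := by ring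
      _ ≤ K ^ 8 := mul_le_of_le_one_left (by positivity) (by norm_num)
  · have h1 : 0.0936 * (A * (A + 1)) ≤ A ^ 2 := by nlinarith
    have h2 := mul_le_mul_of_nonneg_right h1 (sq_nonneg K)
    linear_combination h2

theorem exists_four_pow_lt {A K X U V : ℝ} {n : ℕ} (hA : 2 ≤ A) (hAK : 1 < A * K) (hX : 1 ≤ X)
    (hU : 0 < U) (hV : 1 < V) (hUV : 4 * U ≤ V)
    (hU8 : 128 * (A * (A + 1)) * (A + 2) ^ 2 * U ≤ K ^ 8) (hVAK : V ≤ (A * K) ^ 2)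
    (hXn : (A * K) ^ (n - 1) ≤ X)
    (one_le : ∀ k : ℕ, 0 < k →
      1 ≤ 32 * (A + 2) ^ 2 * U ^ k / X + A * (A + 1) * X / V ^ k) :
    ∃ j : ℕ, 4 ^ j < K ^ 8 ∧ n - 1 ≤ 2 * (j + 1) := by
  have hex : ∃ k, 2 * (A * (A + 1)) * X ≤ V ^ k :=
    (pow_unbounded_of_one_lt _ hV).imp fun _ h => h.le
  classical
  obtain ⟨k, hk, hmin⟩ : ∃ k, 2 * (A * (A + 1)) * X ≤ V ^ k ∧
      ∀ j < k, V ^ j < 2 * (A * (A + 1)) * X :=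
    ⟨Nat.find hex, Nat.find_spec hex, fun j hj => not_le.1 (Nat.find_min hex hj)⟩
  have hA6 : 6 ≤ A * (A + 1) := by nlinarith
  have hAX : 12 * X ≤ 2 * (A * (A + 1)) * X :=
    mul_le_mul_of_nonneg_right (by linarith) (by linarith)
  have hk0 : 0 < k := by
    rcases Nat.eq_zero_or_pos k with rfl | h
    · rw [pow_zero] at hk; linarith
    · exact h
  obtain ⟨j, rfl⟩ : ∃ j, k = j + 1 := ⟨k - 1, by omega⟩
  have hVk : 0 < V ^ (j + 1) := by positivity
  have hXU : X ≤ 64 * (A + 2) ^ 2 * U ^ (j + 1) := by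
    have i1 := one_le _ hk0
    have i2 : A * (A + 1) * X / V ^ (j + 1) ≤ 1 / 2 := by
      rw [div_le_iff₀ hVk]
      linarith
    have i3 : 1 / 2 ≤ 32 * (A + 2) ^ 2 * U ^ (j + 1) / X := by linarith
    rw [le_div_iff₀ (by linarith)] at i3
    linarith
  refine ⟨j, lt_of_lt_of_le ?_ hU8, ?_⟩
  · have i1 : (4 * U) ^ j ≤ V ^ j := pow_le_pow_left₀ (by positivity) hUV j
    have i2 := hmin j j.lt_succ_self
    have i3 := mul_le_mul_of_nonneg_left hXU (by positivity : 0 ≤ 2 * (A * (A + 1)))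
    rw [mul_pow] at i1
    refine lt_of_mul_lt_mul_right ?_ (by positivity : 0 ≤ U ^ j)
    calc 4 ^ j * U ^ j ≤ V ^ j := i1
      _ < 2 * (A * (A + 1)) * X := i2
      _ ≤ _ := i3
      _ = _ := by ring
  · by_contra! hlt
    have i1 := pow_lt_pow_right₀ hAK hlt
    have i2 : V ^ (j + 1) ≤ (A * K) ^ (2 * (j + 1)) := by
      rw [pow_mul]; exact pow_le_pow_left₀ (by linarith) hVAK _
    linarith

theorem false_of_pell_of_le {X Y Z d : ℤ} (hA : 2 ≤ A) (hK : 23000 ≤ K) (hKA : 240 * (A + 1) ≤ K)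
    (hσ : σ = 1 ∨ σ = -1) (hX : 0 < X) (hY : 0 < Y) (hZ : 0 < Z) (h1 : X ^ 2 = K * d + 4)
    (h2 : Y ^ 2 = (A ^ 2 * K + 4 * σ * A) * d + 4)
    (h3 : Z ^ 2 = ((A + 1) ^ 2 * K + 4 * σ * (A + 1)) * d + 4) {n : ℕ} (hn : 150 ≤ n)
    (hKn : K ≤ n ^ 2 + 2 * n) (hXn : (A * K) ^ (n - 1) ≤ X) : False := by
  have hA' : (2 : ℝ) ≤ A := by exact_mod_cast hA
  have hK' : (23000 : ℝ) ≤ K := by exact_mod_cast hK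
  obtain ⟨hUV, hU8, hVAK⟩ := bounds_of_le hA' hK' (by exact_mod_cast hKA)
  have hAK : 2 * (23000 : ℝ) ≤ A * K := mul_le_mul hA' hK' (by norm_num) (by linarith)
  obtain ⟨j, hj, hnj⟩ := exists_four_pow_lt (X := X) (n := n) hA' (by linarith)
    (by exact_mod_cast hX) (div_pos (by positivity) (by linarith))
    (by nlinarith [mul_pos (show (0 : ℝ) < A by linarith) (show (0 : ℝ) < K by linarith)])
    hUV hU8 hVAK
    (by exact_mod_cast hXn) fun k hk => one_le_of_pell hA hK hσ hX hY hZ h1 h2 h3 hk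
  have h2n : 2 ^ (n - 3) ≤ 4 ^ j := by
    rw [show 4 = 2 ^ 2 by rfl, ← pow_mul]
    exact Nat.pow_le_pow_right two_pos (by omega)
  have hKn2 : K ^ 8 ≤ ((n : ℤ) + 1) ^ 16 := by
    have h : K ≤ ((n : ℤ) + 1) ^ 2 := by linarith
    have := pow_le_pow_left₀ (by linarith) h 8
    rwa [← pow_mul] at this
  have h5 : ((n + 1 : ℕ) : ℤ) ^ 16 ≤ 4 ^ j := by
    exact_mod_cast (succ_pow_sixteen_le_two_pow hn).trans h2n
  have h6 : (4 : ℤ) ^ j < K ^ 8 := by exact_mod_cast hj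
  push_cast at h5
  linarith

end Contradiction

section Pell

/-- The sequence `u 0 = p`, `u 1 = q`, `u (n + 2) = r * u (n + 1) - u n`. -/
def recSeq (r p q : ℤ) : ℕ → ℤ
  | 0 => p
  | 1 => q
  | n + 2 => r * recSeq r p q (n + 1) - recSeq r p q n

theorem recSeq_add_two (r p q : ℤ) (n : ℕ) :
    recSeq r p q (n + 2) = r * recSeq r p q (n + 1) - recSeq r p q n := rfl

theorem even_iff_of_sq_eq {x a d : ℤ} (h : x ^ 2 = a * d + 4) : Even x ↔ Even a ∨ Even d := by
  have h1 : Even (x ^ 2) ↔ Even (a * d + 4) := by rw [h]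
  simpa [Int.even_add, Int.even_pow, Int.even_mul, show Even (4 : ℤ) from ⟨2, rfl⟩] using h1

variable {a b r X Y d : ℤ}

theorem even_mul_sub_mul (hr2 : r ^ 2 = a * b + 4) (h1 : X ^ 2 = a * d + 4)
    (h2 : Y ^ 2 = b * d + 4) : Even (r * X - a * Y) := by
  simp only [Int.even_sub, Int.even_mul, even_iff_of_sq_eq hr2, even_iff_of_sq_eq h1,
    even_iff_of_sq_eq h2]
  tauto

theorem sq_mul_eq (hr2 : r ^ 2 = a * b + 4) (h1 : X ^ 2 = a * d + 4) (h2 : Y ^ 2 = b * d + 4) :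
    (a * Y) ^ 2 = (r ^ 2 - 4) * X ^ 2 - 4 * (a * (b - a)) := by
  linear_combination a ^ 2 * h2 - a * b * h1 - X ^ 2 * hr2

theorem exists_pell_neighbour (hr2 : r ^ 2 = a * b + 4) (h1 : X ^ 2 = a * d + 4)
    (h2 : Y ^ 2 = b * d + 4) :
    ∃ X' Y' d', X' ^ 2 = a * d' + 4 ∧ Y' ^ 2 = b * d' + 4 ∧ r * X - a * Y = X' + X' ∧
      r * X' + a * Y' = 2 * X := by
  obtain ⟨X', hX'⟩ := even_mul_sub_mul hr2 h1 h2
  obtain ⟨Y', hY'⟩ := even_mul_sub_mul (hr2.trans (by rw [mul_comm])) h2 h1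
  obtain ⟨D, hD⟩ : Even (a * b * d - r * X * Y) := by
    simp only [Int.even_sub, Int.even_mul, even_iff_of_sq_eq hr2, even_iff_of_sq_eq h1,
      even_iff_of_sq_eq h2]
    tauto
  refine ⟨X', Y', a + b + d + D, ?_, ?_, hX', ?_⟩
  · have : (X' + X') ^ 2 = 4 * (a * (a + b + d + D) + 4) := by
      rw [← hX']
      linear_combination X ^ 2 * hr2 + (a * b + 4) * h1 + a ^ 2 * h2 + 2 * a * hD
    linarith
  · have : (Y' + Y') ^ 2 = 4 * (b * (a + b + d + D) + 4) := by
      rw [← hY']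
      linear_combination Y ^ 2 * hr2 + (a * b + 4) * h2 + b ^ 2 * h1 + 2 * b * hD
    linarith
  · have : 2 * (r * X' + a * Y') = 2 * (2 * X) := by
      linear_combination -r * hX' - a * hY' + X * hr2
    linarith

theorem exists_pell_descent (ha : 0 < a) (hab : a < b) (hr : 2 < r)
    (hr2 : r ^ 2 = a * b + 4) (hX : 0 < X) (hY0 : 0 < Y) (hs : a * (b - a) < (r - 2) * X ^ 2)
    (h1 : X ^ 2 = a * d + 4) (h2 : Y ^ 2 = b * d + 4) :
    ∃ X' Y' d', 0 < X' ∧ X' < X ∧ (0 < Y' ∨ (r - 2) * X' ^ 2 ≤ a * (b - a)) ∧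
      X' ^ 2 = a * d' + 4 ∧ Y' ^ 2 = b * d' + 4 ∧ r * X - a * Y = X' + X' ∧
      r * X' + a * Y' = 2 * X := by
  obtain ⟨X', Y', d', h1', h2', hX', hX2⟩ := exists_pell_neighbour hr2 h1 h2
  have norm_eq := sq_mul_eq hr2 h1 h2
  have norm_eq' := sq_mul_eq hr2 h1' h2'
  have hab' : 0 < a * (b - a) := mul_pos ha (by linarith)
  have haY : 0 < a * Y := mul_pos ha hY0
  have hX'0 : 0 < X' := by
    have : a * Y < r * X := lt_of_pow_lt_pow_left₀ 2 (by positivity) (by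
      rw [norm_eq, mul_pow]; linarith [sq_nonneg X])
    linarith
  have hX'X : X' < X := by
    have : (r - 2) * X < a * Y := lt_of_pow_lt_pow_left₀ 2 haY.le (by
      rw [norm_eq, mul_pow]; linarith)
    linarith
  have hY'0 : 0 < Y' ∨ (r - 2) * X' ^ 2 ≤ a * (b - a) := by
    rcases lt_or_ge 0 Y' with h | h
    · exact Or.inl h
    · right
      have haY' : 0 ≤ -(a * Y') := neg_nonneg.2 (mul_nonpos_of_nonneg_of_nonpos ha.le h)
      have := pow_le_pow_left₀ haY' (show -(a * Y') ≤ (r - 2) * X' by linarith) 2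
      rw [neg_sq, norm_eq', mul_pow] at this
      linarith
  exact ⟨X', Y', _, hX'0, hX'X, hY'0, h1', h2', hX', hX2⟩

theorem exists_recSeq_of_pell (ha : 0 < a) (hab : a < b) (hr : 2 < r) (hr2 : r ^ 2 = a * b + 4)
    (N : ℕ) (hX : 0 < X) (hXN : X ≤ N) (hY : 0 < Y ∨ (r - 2) * X ^ 2 ≤ a * (b - a))
    (h1 : X ^ 2 = a * d + 4) (h2 : Y ^ 2 = b * d + 4) :
    ∃ (m : ℕ) (x y z e : ℤ), 0 < x ∧ (r - 2) * x ^ 2 ≤ a * (b - a) ∧ x ^ 2 = a * e + 4 ∧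
      y ^ 2 = b * e + 4 ∧ 2 * z = r * x + a * y ∧ X = recSeq r x z m ∧
      2 * recSeq r x z (m + 1) = r * X + a * Y := by
  induction N generalizing X Y d with
  | zero => rw [Nat.cast_zero] at hXN; omega
  | succ N ih =>
    rcases le_or_gt ((r - 2) * X ^ 2) (a * (b - a)) with hs | hs
    · obtain ⟨z, hz⟩ : Even (r * X + a * Y) := by
        simpa using even_mul_sub_mul hr2 h1 ((neg_sq Y).trans h2)
      exact ⟨0, X, Y, z, d, hX, hs, h1, h2, by omega, rfl, by simp only [recSeq]; omega⟩
    obtain ⟨X', Y', d', hX'0, hX'X, hY'0, h1', h2', hX', hX2⟩ :=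
      exists_pell_descent ha hab hr hr2 hX (hY.resolve_right hs.not_ge) hs h1 h2
    obtain ⟨m, x, y, z, e, hx, hs', hxe, hye, hz, hm, hm1⟩ :=
      ih hX'0 (by push_cast at hXN; omega) hY'0 h1' h2'
    have hX1 : X = recSeq r x z (m + 1) := by linarith
    refine ⟨m + 1, x, y, z, e, hx, hs', hxe, hye, hz, hX1, ?_⟩
    rw [recSeq_add_two, ← hX1, ← hm]
    linarith

variable {A B K σ : ℤ}

theorem lt_of_sub_two_mul_sq_le {x : ℤ} (hB : 2 ≤ B) (hK : 23000 ≤ K) (hσ : σ = 1 ∨ σ = -1)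
    (h : (B * K + 2 * σ - 2) * x ^ 2 ≤ K * (B ^ 2 * K + 4 * σ * B - K)) : x ^ 2 < B * K + 5 := by
  have hBK : 2 * K ≤ B * K := mul_le_mul_of_nonneg_right hB (by linarith)
  have hKK : 23000 * K ≤ K * K := mul_le_mul_of_nonneg_right hK (by linarith)
  by_contra! hx
  have h1 := mul_le_mul_of_nonneg_left hx
    (show 0 ≤ B * K + 2 * σ - 2 by rcases hσ with rfl | rfl <;> linarith)
  rcases hσ with rfl | rfl <;> linarith

theorem nonneg_and_le_of_sq_eq {x e : ℤ} (hK : 5 ≤ K) (hx : x ^ 2 = K * e + 4)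
    (hxB : x ^ 2 < B * K + 5) : 0 ≤ e ∧ e ≤ B := by
  constructor <;> by_contra! h
  · have := mul_le_mul_of_nonneg_left (show e ≤ -1 by omega) (show 0 ≤ K by linarith)
    linarith [sq_nonneg x]
  · have := mul_le_mul_of_nonneg_left (show B + 1 ≤ e by omega) (show 0 ≤ K by linarith)
    linarith

theorem even_mul_add {x y e : ℤ} (hx : x ^ 2 = K * e + 4)
    (hy : y ^ 2 = (B ^ 2 * K + 4 * σ * B) * e + 4) : Even (B * x + y) := by
  simp only [Int.even_add, Int.even_mul, even_iff_of_sq_eq hx, even_iff_of_sq_eq hy,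
    Int.even_pow, show Even (4 : ℤ) from ⟨2, rfl⟩]
  tauto

theorem exists_recSeq_of_sq_eq (hB : 2 ≤ B) (hK : 23000 ≤ K) (hσ : σ = 1 ∨ σ = -1) (hX : 0 < X)
    (hY : 0 < Y) (h1 : X ^ 2 = K * d + 4) (h2 : Y ^ 2 = (B ^ 2 * K + 4 * σ * B) * d + 4) :
    ∃ (m : ℕ) (x y w e : ℤ), 0 < x ∧ 0 ≤ e ∧ e ≤ B ∧ x ^ 2 = K * e + 4 ∧
      y ^ 2 = (B ^ 2 * K + 4 * σ * B) * e + 4 ∧ 2 * w = B * x + y ∧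
      X = recSeq (B * K + 2 * σ) x (σ * x + K * w) m := by
  have hBK : 2 * K ≤ B * K := mul_le_mul_of_nonneg_right hB (by linarith)
  have hB2 : 2 * (B * K) ≤ B ^ 2 * K := by
    rw [sq, mul_assoc]; exact mul_le_mul_of_nonneg_right hB (by linarith)
  have hBK' : B * 23000 ≤ B * K := mul_le_mul_of_nonneg_left hK (by linarith)
  have hσ2 : σ ^ 2 = 1 := by rcases hσ with rfl | rfl <;> norm_num
  obtain ⟨m, x, y, z, e, hx, hs, hxe, hye, hz, hm, -⟩ :=
    exists_recSeq_of_pell (a := K) (b := B ^ 2 * K + 4 * σ * B) (r := B * K + 2 * σ) (by linarith)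
      (by rcases hσ with rfl | rfl <;> linarith) (by rcases hσ with rfl | rfl <;> linarith)
      (by linear_combination 4 * hσ2) X.toNat hX (by omega) (Or.inl hY) h1 h2
  obtain ⟨he0, heB⟩ :=
    nonneg_and_le_of_sq_eq (by linarith) hxe (lt_of_sub_two_mul_sq_le hB hK hσ hs)
  obtain ⟨w, hw⟩ := even_mul_add hxe hye
  have hzw : z = σ * x + K * w := by
    have : 2 * z = 2 * (σ * x + K * w) := by linear_combination hz + K * hw
    linarith
  exact ⟨m, x, y, w, e, hx, he0, heB, hxe, hye, by omega, hzw ▸ hm⟩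

theorem recSeq_modEq (hσ : σ ^ 2 = 1) (x w : ℤ) (m : ℕ) :
    recSeq (B * K + 2 * σ) x (σ * x + K * w) m ≡ σ ^ m * x [ZMOD K] := by
  induction m using Nat.twoStepInduction with
  | zero => simp [recSeq]
  | one => simp [recSeq, Int.ModEq]
  | more m ih ih' =>
    rw [recSeq_add_two]
    have h : B * K + 2 * σ ≡ 2 * σ [ZMOD K] := by simp [Int.ModEq]
    refine ((h.mul ih').sub ih).trans (congrArg (· % K) ?_)
    linear_combination σ ^ m * x * hσ

theorem recSeq_two_modEq (hσ : σ ^ 2 = 1) (δ : ℤ) (m : ℕ) :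
    recSeq (B * K + 2 * σ) 2 (σ * 2 + K * (B + δ)) m ≡
      σ ^ m * (2 + σ * K * (B * m ^ 2 + δ * m)) [ZMOD K ^ 2] := by
  induction m using Nat.twoStepInduction with
  | zero => simp [recSeq]
  | one =>
    refine congrArg (· % K ^ 2) ?_
    simp only [recSeq, Nat.cast_one]
    linear_combination -K * (B + δ) * hσ
  | more m ih ih' =>
    rw [recSeq_add_two]
    refine ((ih'.mul_left _).sub ih).trans (Int.modEq_iff_dvd.2 ?_)
    push_cast
    refine ⟨-B * σ ^ m * (B * (m + 1) ^ 2 + δ * (m + 1)), ?_⟩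
    linear_combination (-2 * σ ^ m + σ ^ m * σ * K * (B * (m + 2) ^ 2 + δ * (m + 2) -
      2 * (B * (m + 1) ^ 2 + δ * (m + 1))) - B * K ^ 2 * σ ^ m * (B * (m + 1) ^ 2 +
      δ * (m + 1))) * hσ

theorem eq_of_modEq {x x' : ℤ} {m n : ℕ} (hσ : σ = 1 ∨ σ = -1) (hx : 0 < x) (hx' : 0 < x')
    (hxK : 2 * x < K) (hxK' : 2 * x' < K) (h : σ ^ m * x ≡ σ ^ n * x' [ZMOD K]) :
    x = x' ∧ σ ^ m = σ ^ n := by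
  have key : ∀ k : ℕ, σ ^ k = 1 ∨ σ ^ k = -1 := fun k => by
    rcases hσ with rfl | rfl
    · simp
    · exact neg_one_pow_eq_or ℤ k
  obtain ⟨q, hq⟩ := h.dvd
  have hq0 : q = 0 := by
    have : -1 < q := by
      by_contra! hc
      rcases key m with h1 | h1 <;> rcases key n with h2 | h2 <;> rw [h1, h2] at hq <;> nlinarith
    have : q < 1 := by
      by_contra! hc
      rcases key m with h1 | h1 <;> rcases key n with h2 | h2 <;> rw [h1, h2] at hq <;> nlinarith
    omega
  rw [hq0, mul_zero] at hq
  rcases key m with h1 | h1 <;> rcases key n with h2 | h2 <;> rw [h1, h2] at hq ⊢ <;> omega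

theorem eq_of_mul_sub_eq {x f g τ : ℤ} (hA : 2 ≤ A) (hx : 151 ≤ x) (hτ : -A ≤ τ) (hτ' : τ ≤ A)
    (hf2 : 2 * f ≤ A * x) (hg2 : 2 * g ≤ (A + 1) * x) (hf : f * (A * x - f) = A ^ 2 - A * τ - 1)
    (hg : g * ((A + 1) * x - g) = (A + 1) ^ 2 - (A + 1) * τ - 1) : f = g := by
  have hAx : A * 151 ≤ A * x := mul_le_mul_of_nonneg_left hx (by linarith)
  have hAτ : A * τ ≤ A * A := mul_le_mul_of_nonneg_left hτ' (by linarith)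
  have hf0 : 0 ≤ f := by
    by_contra! h
    have := mul_le_mul_of_nonneg_right (show f ≤ -1 by omega) (show 0 ≤ A * x - f by linarith)
    linarith
  rcases lt_trichotomy f g with h | h | h
  · have h1 := mul_nonneg (show 0 ≤ g - (f + 1) by linarith)
      (show 0 ≤ (A + 1) * x - g - (f + 1) by linarith)
    have h2 := mul_nonneg hf0 (show 0 ≤ x - 2 by linarith)
    linarith
  · exact h
  · exfalso
    have h1 := mul_nonneg (show 0 ≤ f - (g + 1) by linarith)
      (show 0 ≤ A * x - f - (g + 1) by linarith)
    have h2 : A * 151 ≤ g * (x + 2) := by linarith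
    have hg0 : 0 < g := pos_of_mul_pos_left (by linarith) (show 0 ≤ x + 2 by linarith)
    have h3 := mul_nonneg hg0.le (show 0 ≤ (A + 1) * x - 2 * g by linarith)
    have h4 : (A + 1) * -A ≤ (A + 1) * τ := mul_le_mul_of_nonneg_left hτ (by linarith)
    have h5 : g * x ≤ 4 * A + 2 := le_of_mul_le_mul_left (a := A + 1) (by linarith) (by linarith)
    have h6 := mul_le_mul_of_nonneg_left hx hg0.le
    linarith

theorem eq_zero_of_sq_eq {x y z e : ℤ} (hA : 2 ≤ A) (hK : 23000 ≤ K) (hσ : σ = 1 ∨ σ = -1)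
    (hx0 : 0 < x) (he : 0 ≤ e) (heA : e ≤ A) (hx : x ^ 2 = K * e + 4)
    (hy : y ^ 2 = (A ^ 2 * K + 4 * σ * A) * e + 4)
    (hz : z ^ 2 = ((A + 1) ^ 2 * K + 4 * σ * (A + 1)) * e + 4) : e = 0 := by
  by_contra hne
  have hxl : 151 ≤ x := by
    by_contra! h
    have := mul_le_mul_of_nonneg_left (show 1 ≤ e by omega) (show 0 ≤ K by linarith)
    have := pow_le_pow_left₀ hx0.le (show x ≤ 150 by omega) 2
    linarith
  rw [← sq_abs] at hy hz
  obtain ⟨f, hf⟩ := even_mul_add hx ((neg_sq |y|).trans hy)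
  obtain ⟨g, hg⟩ := even_mul_add hx ((neg_sq |z|).trans hz)
  have hf' : f * (A * x - f) = A ^ 2 - A * (σ * e) - 1 := by
    rw [show |y| = A * x - 2 * f by linarith] at hy
    have : A ^ 2 * x ^ 2 = A ^ 2 * (K * e + 4) := by rw [hx]
    linarith
  have hg' : g * ((A + 1) * x - g) = (A + 1) ^ 2 - (A + 1) * (σ * e) - 1 := by
    rw [show |z| = (A + 1) * x - 2 * g by linarith] at hz
    have : (A + 1) ^ 2 * x ^ 2 = (A + 1) ^ 2 * (K * e + 4) := by rw [hx]
    linarith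
  have hfg : f = g := eq_of_mul_sub_eq hA hxl
    (by rcases hσ with rfl | rfl <;> linarith) (by rcases hσ with rfl | rfl <;> linarith)
    (by linarith [abs_nonneg y]) (by linarith [abs_nonneg z]) hf' hg'
  subst hfg
  have hfx : f * x = 2 * A + 1 - σ * e := by linarith
  have hf2 : f ^ 2 = A ^ 2 + A + 1 := by linear_combination A * hfx - hf'
  have h1 : A < |f| := lt_of_pow_lt_pow_left₀ 2 (abs_nonneg f) (by rw [sq_abs]; linarith)
  have h2 : |f| < A + 1 := lt_of_pow_lt_pow_left₀ 2 (by linarith) (by rw [sq_abs]; linarith)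
  omega

/-- A solution of the system of Pellian equations lies in both sequences started at `d = 0`. -/
theorem exists_recSeq_two {X Y Z d : ℤ} (hA : 2 ≤ A) (hK : 23000 ≤ K) (hKA : 240 * (A + 1) ≤ K)
    (hσ : σ = 1 ∨ σ = -1) (hX : 0 < X) (hY : 0 < Y) (hZ : 0 < Z) (h1 : X ^ 2 = K * d + 4)
    (h2 : Y ^ 2 = (A ^ 2 * K + 4 * σ * A) * d + 4)
    (h3 : Z ^ 2 = ((A + 1) ^ 2 * K + 4 * σ * (A + 1)) * d + 4) :
    ∃ (m n : ℕ) (δ δ' : ℤ), (δ = 1 ∨ δ = -1) ∧ (δ' = 1 ∨ δ' = -1) ∧ σ ^ m = σ ^ n ∧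
      X = recSeq (A * K + 2 * σ) 2 (σ * 2 + K * (A + δ)) m ∧
      X = recSeq ((A + 1) * K + 2 * σ) 2 (σ * 2 + K * (A + 1 + δ')) n := by
  have hσ2 : σ ^ 2 = 1 := by rcases hσ with rfl | rfl <;> norm_num
  obtain ⟨m, x, y, w, e, hx0, he0, heA, hx, hy, hw, hm⟩ :=
    exists_recSeq_of_sq_eq hA hK hσ hX hY h1 h2
  obtain ⟨n, x', z, w', e', hx0', he0', heA', hx', hz, hw', hn⟩ :=
    exists_recSeq_of_sq_eq (by linarith) hK hσ hX hZ h1 h3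
  have small : ∀ {x e : ℤ}, 0 < x → e ≤ A + 1 → x ^ 2 = K * e + 4 → 2 * x < K :=
    fun {x e} h h' h'' => lt_of_pow_lt_pow_left₀ 2 (by linarith) (by
      have i1 := mul_le_mul_of_nonneg_left h' (show 0 ≤ K by linarith)
      have i2 := mul_le_mul_of_nonneg_left hKA (show 0 ≤ K by linarith)
      have i3 := mul_le_mul_of_nonneg_left hK (show 0 ≤ K by linarith)
      linarith)
  have hmod := (recSeq_modEq (B := A) (K := K) hσ2 x w m).symm.trans
    ((hm.symm.trans hn) ▸ recSeq_modEq (B := A + 1) (K := K) hσ2 x' w' n)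
  obtain ⟨rfl, hmn⟩ := eq_of_modEq hσ hx0 hx0' (small hx0 (by linarith) hx)
    (small hx0' heA' hx') hmod
  obtain rfl : e = e' := mul_left_cancel₀ (show K ≠ 0 by linarith) (by linarith)
  obtain rfl := eq_zero_of_sq_eq hA hK hσ hx0 he0 heA hx hy hz
  have sign : ∀ {y : ℤ}, y ^ 2 = 4 → ∃ δ, (δ = 1 ∨ δ = -1) ∧ y = 2 * δ := fun {y} h => by
    rcases sq_eq_sq_iff_eq_or_eq_neg.1 (h.trans (show (4 : ℤ) = 2 ^ 2 by norm_num)) with h | h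
    · exact ⟨1, Or.inl rfl, h⟩
    · exact ⟨-1, Or.inr rfl, h⟩
  obtain ⟨δ, hδ, rfl⟩ := sign (y := y) (by linarith)
  obtain ⟨δ', hδ', rfl⟩ := sign (y := z) (by linarith)
  obtain rfl : x = 2 := by nlinarith
  obtain rfl : w = A + δ := by linarith
  obtain rfl : w' = A + 1 + δ' := by linarith
  exact ⟨m, n, δ, δ', hδ, hδ', hmn, hm, hn⟩

theorem dvd_of_recSeq_eq {X δ δ' : ℤ} {m n : ℕ} (hσ : σ = 1 ∨ σ = -1) (hK : K ≠ 0)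
    (hmn : σ ^ m = σ ^ n) (hm : X = recSeq (A * K + 2 * σ) 2 (σ * 2 + K * (A + δ)) m)
    (hn : X = recSeq (B * K + 2 * σ) 2 (σ * 2 + K * (B + δ')) n) :
    K ∣ B * n ^ 2 + δ' * n - (A * m ^ 2 + δ * m) := by
  have hσ2 : σ ^ 2 = 1 := by rcases hσ with rfl | rfl <;> norm_num
  have h := (recSeq_two_modEq (B := A) (K := K) hσ2 δ m).symm.trans
    ((hm.symm.trans hn) ▸ recSeq_two_modEq (B := B) (K := K) hσ2 δ' n)
  obtain ⟨q, hq⟩ := h.dvd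
  have hn2 : (σ ^ n) ^ 2 = 1 := by rw [← pow_mul, mul_comm, pow_mul, hσ2, one_pow]
  rw [hmn] at hq
  refine ⟨σ ^ n * σ * q, mul_left_cancel₀ hK ?_⟩
  linear_combination σ ^ n * σ * hq - K * (B * n ^ 2 + δ' * n - (A * m ^ 2 + δ * m)) *
    (σ ^ 2 * hn2 + hσ2)

theorem recSeq_bounds {r p q : ℤ} (hr : 2 ≤ r) (hp : 0 ≤ p) (hpq : p ≤ q) (n : ℕ) :
    0 ≤ recSeq r p q n ∧ recSeq r p q n ≤ recSeq r p q (n + 1) ∧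
      q * (r - 1) ^ n ≤ recSeq r p q (n + 1) ∧ recSeq r p q (n + 1) ≤ q * r ^ n := by
  induction n with
  | zero => simp [recSeq, hp, hpq]
  | succ n ih =>
    obtain ⟨h0, h1, h2, h3⟩ := ih
    rw [recSeq_add_two]
    have h4 := mul_le_mul_of_nonneg_right hr (h0.trans h1)
    have h5 := mul_le_mul_of_nonneg_right h2 (show 0 ≤ r - 1 by linarith)
    have h6 := mul_le_mul_of_nonneg_right h3 (show 0 ≤ r by linarith)
    rw [pow_succ, pow_succ]
    exact ⟨h0.trans h1, by linarith, by linarith, by linarith⟩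

theorem div_pow_le_four {a : ℕ} {k s : ℝ} (ha : 2 ≤ a) (hk : 23000 ≤ k) (hs : -1 ≤ s) :
    (((a + 1) * k + 2 * s) / (a * k + 2 * s - 1)) ^ a ≤ 4 := by
  have ha' : (2 : ℝ) ≤ a := by exact_mod_cast ha
  have hak : (a : ℝ) * 23000 ≤ a * k := mul_le_mul_of_nonneg_left hk (by linarith)
  have hD : 0 < a * k + 2 * s - 1 := by linarith
  have e : ((a + 1) * k + 2 * s) / (a * k + 2 * s - 1) = (k + 1) / (a * k + 2 * s - 1) + 1 := by
    field_simp
    ring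
  have hlog : Real.log 4 = 2 * Real.log 2 := by
    rw [show (4 : ℝ) = 2 ^ 2 by norm_num, Real.log_pow]; norm_num
  rw [e]
  refine (pow_le_pow_left₀ (by positivity) (Real.add_one_le_exp _) a).trans ?_
  rw [← Real.exp_nat_mul, ← Real.le_log_iff_exp_le (by norm_num), hlog, mul_div_assoc',
    div_le_iff₀ hD]
  have := mul_le_mul_of_nonneg_right (show (1.3 : ℝ) ≤ 2 * Real.log 2 by
    linarith [Real.log_two_gt_d9]) hD.le
  linarith

theorem pow_mul_lt_of_lt {n j : ℕ} (hA : 2 ≤ A) (hK : 23000 ≤ K) (hσ : σ = 1 ∨ σ = -1)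
    (hj : 0 < j) (hn : (n : ℤ) < 5 * j * A) :
    (A * K + 2 * σ + 2 * K) * ((A + 1) * K + 2 * σ) ^ n <
      (A * K + 2 * σ - K) * (A * K + 2 * σ - 1) ^ (n + j) := by
  obtain ⟨a, rfl⟩ := Int.eq_ofNat_of_zero_le (show 0 ≤ A by linarith)
  have ha : 2 ≤ a := by exact_mod_cast hA
  have hK' : (23000 : ℝ) ≤ K := by exact_mod_cast hK
  have hσl : (-1 : ℝ) ≤ σ := by rcases hσ with rfl | rfl <;> norm_num
  have hσu : (σ : ℝ) ≤ 1 := by rcases hσ with rfl | rfl <;> norm_num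
  have haK : 2 * (K : ℝ) ≤ a * K :=
    mul_le_mul_of_nonneg_right (by exact_mod_cast ha) (by linarith)
  have h4 := div_pow_le_four ha hK' hσl
  have hs : (a + 1 : ℝ) * K + 2 * σ =
      ((a + 1) * K + 2 * σ) / (a * K + 2 * σ - 1) * (a * K + 2 * σ - 1) := by
    rw [div_mul_cancel₀]; linarith
  have hρ : 1 ≤ ((a + 1) * K + 2 * σ : ℝ) / (a * K + 2 * σ - 1) := by
    rw [one_le_div (by linarith)]; linarith
  generalize ((a + 1) * K + 2 * σ : ℝ) / (a * K + 2 * σ - 1) = ρ at h4 hs hρ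
  have hn' : n ≤ a * (5 * j) := by
    have : (n : ℤ) ≤ (a * (5 * j) : ℕ) := by push_cast; linarith
    exact_mod_cast this
  have hρn : ρ ^ n ≤ 1024 ^ j := calc
    ρ ^ n ≤ ρ ^ (a * (5 * j)) := pow_le_pow_right₀ hρ hn'
    _ = (ρ ^ a) ^ (5 * j) := pow_mul ..
    _ ≤ 4 ^ (5 * j) := pow_le_pow_left₀ (by positivity) h4 _
    _ = 1024 ^ j := by rw [pow_mul]; norm_num
  have hj1 : 44 * 1024 ^ j ≤ (a * K + 2 * σ - 1 : ℝ) ^ j := calc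
    (44 * 1024 ^ j : ℝ) ≤ 44 ^ j * 1024 ^ j :=
      mul_le_mul_of_nonneg_right (le_self_pow₀ (by norm_num) hj.ne') (by positivity)
    _ = (44 * 1024) ^ j := (mul_pow ..).symm
    _ ≤ _ := pow_le_pow_left₀ (by norm_num) (by linarith) j
  have hr : 0 < (a * K + 2 * σ - 1 : ℝ) ^ n := pow_pos (by linarith) n
  suffices h : (a * K + 2 * σ + 2 * K : ℝ) * ((a + 1) * K + 2 * σ) ^ n <
      (a * K + 2 * σ - K) * (a * K + 2 * σ - 1) ^ (n + j) by exact_mod_cast h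
  rw [hs, mul_pow, pow_add]
  calc (a * K + 2 * σ + 2 * K : ℝ) * (ρ ^ n * (a * K + 2 * σ - 1) ^ n)
      ≤ (a * K + 2 * σ + 2 * K : ℝ) * (1024 ^ j * (a * K + 2 * σ - 1) ^ n) :=
        mul_le_mul_of_nonneg_left (mul_le_mul_of_nonneg_right hρn hr.le) (by linarith)
    _ < 44 * (a * K + 2 * σ - K) * (1024 ^ j * (a * K + 2 * σ - 1) ^ n) :=
        mul_lt_mul_of_pos_right (by linarith) (by positivity)
    _ = (a * K + 2 * σ - K) * ((a * K + 2 * σ - 1) ^ n * (44 * 1024 ^ j)) := by ring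
    _ ≤ _ := mul_le_mul_of_nonneg_left (mul_le_mul_of_nonneg_left hj1 hr.le) (by linarith)

theorem index_bounds {X δ δ' : ℤ} {m n : ℕ} (hA : 2 ≤ A) (hK : 23000 ≤ K) (hσ : σ = 1 ∨ σ = -1)
    (hδ : δ = 1 ∨ δ = -1) (hδ' : δ' = 1 ∨ δ' = -1) (hX : 2 < X)
    (hm : X = recSeq (A * K + 2 * σ) 2 (σ * 2 + K * (A + δ)) m)
    (hn : X = recSeq ((A + 1) * K + 2 * σ) 2 (σ * 2 + K * (A + 1 + δ')) n) :
    0 < n ∧ (A * K) ^ (n - 1) ≤ X ∧ ∃ j : ℕ, m = n + j ∧ (0 < j → 5 * j * A ≤ n) := by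
  have hAK : 2 * K ≤ A * K := mul_le_mul_of_nonneg_right hA (by linarith)
  have hσl : -1 ≤ σ := by rcases hσ with rfl | rfl <;> norm_num
  have hσu : σ ≤ 1 := by rcases hσ with rfl | rfl <;> norm_num
  have hδK : -K ≤ K * δ ∧ K * δ ≤ K := by rcases hδ with rfl | rfl <;> constructor <;> linarith
  have hδK' : -K ≤ K * δ' ∧ K * δ' ≤ K := by
    rcases hδ' with rfl | rfl <;> constructor <;> linarith
  obtain - | m := m
  · simp only [recSeq] at hm; linarith
  obtain - | n := n
  · simp only [recSeq] at hn; linarith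
  obtain ⟨-, -, hml, hmu⟩ := recSeq_bounds (r := A * K + 2 * σ) (p := 2)
    (q := σ * 2 + K * (A + δ)) (by linarith) zero_le_two (by linarith) m
  obtain ⟨-, -, hnl, hnu⟩ := recSeq_bounds (r := (A + 1) * K + 2 * σ) (p := 2)
    (q := σ * 2 + K * (A + 1 + δ')) (by linarith) zero_le_two (by linarith) n
  rw [← hm] at hml hmu
  rw [← hn] at hnl hnu
  have hml' := (mul_le_mul_of_nonneg_right
    (show A * K + 2 * σ - K ≤ σ * 2 + K * (A + δ) by linarith)
    (pow_nonneg (show 0 ≤ A * K + 2 * σ - 1 by linarith) m)).trans hml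
  have hmu' := hmu.trans (mul_le_mul_of_nonneg_right
    (show σ * 2 + K * (A + δ) ≤ (A + 1) * K + 2 * σ by linarith)
    (pow_nonneg (show 0 ≤ A * K + 2 * σ by linarith) m))
  have hnl' := (mul_le_mul_of_nonneg_right
    (show A * K + 2 * σ ≤ σ * 2 + K * (A + 1 + δ') by linarith)
    (pow_nonneg (show 0 ≤ (A + 1) * K + 2 * σ - 1 by linarith) n)).trans hnl
  have hnu' := hnu.trans (mul_le_mul_of_nonneg_right
    (show σ * 2 + K * (A + 1 + δ') ≤ A * K + 2 * σ + 2 * K by linarith)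
    (pow_nonneg (show 0 ≤ (A + 1) * K + 2 * σ by linarith) n))
  have hnm : n ≤ m := by
    by_contra! h
    have i1 : (A * K + 2 * σ) ^ m ≤ ((A + 1) * K + 2 * σ - 1) ^ m :=
      pow_le_pow_left₀ (by linarith) (by linarith) m
    have i2 : ((A + 1) * K + 2 * σ - 1) ^ (m + 1) ≤ ((A + 1) * K + 2 * σ - 1) ^ n :=
      pow_le_pow_right₀ (by linarith) h
    have i3 := mul_le_mul_of_nonneg_left i2 (show 0 ≤ A * K + 2 * σ by linarith)
    have i4 := mul_le_mul_of_nonneg_left i1 (show 0 ≤ (A + 1) * K + 2 * σ by linarith)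
    have i5 : 0 < ((A + 1) * K + 2 * σ - 1) ^ m := pow_pos (by linarith) m
    have i6 := mul_le_mul_of_nonneg_right (show 2 ≤ A * K + 2 * σ by linarith)
      (show 0 ≤ (A + 1) * K + 2 * σ - 1 by linarith)
    have i7 := mul_lt_mul_of_pos_right (show (A + 1) * K + 2 * σ <
      (A * K + 2 * σ) * ((A + 1) * K + 2 * σ - 1) by linarith) i5
    rw [pow_succ, mul_comm (((A + 1) * K + 2 * σ - 1) ^ m), ← mul_assoc] at i3
    linarith
  refine ⟨n.succ_pos, ?_, m - n, by omega, fun hj => ?_⟩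
  · refine le_trans ?_ hnl'
    rw [Nat.add_sub_cancel]
    refine (pow_le_pow_left₀ (by linarith)
      (show A * K ≤ (A + 1) * K + 2 * σ - 1 by linarith) n).trans ?_
    exact le_mul_of_one_le_left (pow_nonneg (by linarith) n) (by linarith)
  · by_contra! h
    have := pow_mul_lt_of_lt (n := n) hA hK hσ hj (by push_cast at h; linarith)
    rw [show n + (m - n) = m by omega] at this
    linarith

theorem le_sq_add_of_dvd {δ δ' : ℤ} {n j : ℕ} (hA : 2 ≤ A) (hδ : δ = 1 ∨ δ = -1)
    (hδ' : δ' = 1 ∨ δ' = -1) (hn : 0 < n) (hj : 0 < j → 5 * j * A ≤ n)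
    (hne : ¬(n = 2 ∧ j = 0 ∧ δ = 1 ∧ δ' = -1))
    (h : K ∣ (A + 1) * n ^ 2 + δ' * n - (A * (n + j) ^ 2 + δ * (n + j))) :
    K ≤ n ^ 2 + 2 * n := by
  have hn' : (1 : ℤ) ≤ n := by exact_mod_cast hn
  have hδn : -n ≤ δ * n ∧ δ * n ≤ n := by rcases hδ with rfl | rfl <;> constructor <;> linarith
  have hδn' : -n ≤ δ' * n ∧ δ' * n ≤ n := by
    rcases hδ' with rfl | rfl <;> constructor <;> linarith
  rcases Nat.eq_zero_or_pos j with rfl | hj0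
  · have h1 : K ∣ n * (n + (δ' - δ)) := by
      convert h using 1; push_cast; ring
    have h2 : (n : ℤ) * (n + (δ' - δ)) ≠ 0 := by
      refine mul_ne_zero (by omega) fun h0 => hne ?_
      omega
    have h3 := Int.le_of_dvd (abs_pos.2 h2) ((dvd_abs _ _).2 h1)
    refine h3.trans (abs_le.2 ⟨?_, ?_⟩) <;> nlinarith
  · have hj1 : (1 : ℤ) ≤ j := by exact_mod_cast hj0
    have hjA := hj hj0
    have hδj : -j ≤ δ * j ∧ δ * j ≤ j := by
      rcases hδ with rfl | rfl <;> constructor <;> linarith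
    have hjA2 : j * 2 ≤ (j : ℤ) * A := mul_le_mul_of_nonneg_left hA (by linarith)
    have h1 := mul_le_mul_of_nonneg_left hjA (show (0 : ℤ) ≤ n by linarith)
    have h2 := mul_le_mul_of_nonneg_left hjA (show (0 : ℤ) ≤ j by linarith)
    have h3 := mul_le_mul_of_nonneg_left (hjA2) (show (0 : ℤ) ≤ n by linarith)
    have h4 := mul_le_mul_of_nonneg_left hj1 (show (0 : ℤ) ≤ n by linarith)
    have h5 := mul_le_mul_of_nonneg_left hjA2 (show (0 : ℤ) ≤ j by linarith)
    have h6 := mul_le_mul_of_nonneg_left hj1 (show (0 : ℤ) ≤ j by linarith)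
    refine (Int.le_of_dvd ?_ h).trans ?_
    · linarith
    · linarith

theorem false_of_pell {X Y Z d : ℤ} (hA : 2 ≤ A) (hK : 23000 ≤ K) (hKA : 240 * (A + 1) ≤ K)
    (hσ : σ = 1 ∨ σ = -1) (hX : 0 < X) (hY : 0 < Y) (hZ : 0 < Z) (hd : 0 < d)
    (h1 : X ^ 2 = K * d + 4) (h2 : Y ^ 2 = (A ^ 2 * K + 4 * σ * A) * d + 4)
    (h3 : Z ^ 2 = ((A + 1) ^ 2 * K + 4 * σ * (A + 1)) * d + 4)
    (hirr : d ≠ (A * K + 2 * σ) * ((A + 1) * K + 2 * σ) *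
      (A * (A + 1) * K + 2 * σ * (2 * A + 1))) : False := by
  have hσ2 : σ ^ 2 = 1 := by rcases hσ with rfl | rfl <;> norm_num
  have hX2 : 2 < X := lt_of_pow_lt_pow_left₀ 2 hX.le (by
    rw [h1]; linarith [mul_pos (show 0 < K by linarith) hd])
  obtain ⟨m, n, δ, δ', hδ, hδ', hmn, hm, hn⟩ := exists_recSeq_two hA hK hKA hσ hX hY hZ h1 h2 h3
  obtain ⟨hn0, hXn, j, rfl, hj⟩ := index_bounds hA hK hσ hδ hδ' hX2 hm hn
  have hdvd := dvd_of_recSeq_eq hσ (show K ≠ 0 by linarith) hmn hm hn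
  push_cast at hdvd
  by_cases hne : n = 2 ∧ j = 0 ∧ δ = 1 ∧ δ' = -1
  · obtain ⟨rfl, rfl, rfl, rfl⟩ := hne
    simp only [recSeq] at hm
    refine hirr (mul_left_cancel₀ (show K ≠ 0 by linarith) ?_)
    have : K * d = X ^ 2 - 4 := by linarith
    rw [this, hm]
    linear_combination 4 * (A * K + 2 * σ) * ((A + 1) * K + 2 * σ) * hσ2
  · have hKn := le_sq_add_of_dvd hA hδ hδ' hn0 hj hne hdvd
    refine false_of_pell_of_le hA hK hKA hσ hX hY hZ h1 h2 h3 (n := n) ?_ hKn hXn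
    by_contra! h
    have : (n : ℤ) ≤ 149 := by omega
    nlinarith

end Pell

theorem exists_pos_sq_eq {x : ℤ} (h : IsSquare x) (hx : 0 < x) : ∃ y, 0 < y ∧ y ^ 2 = x := by
  obtain ⟨y, rfl⟩ := h
  exact ⟨|y|, abs_pos.2 (by rintro rfl; simp at hx), by rw [sq_abs, sq]⟩

theorem not_le_of_isDiophQuadruple {A K σ d : ℤ} (hσ : σ = 1 ∨ σ = -1)
    (h : IsDiophQuadruple 4 K (A ^ 2 * K + 4 * σ * A) ((A + 1) ^ 2 * K + 4 * σ * (A + 1)) d)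
    (hirr : d ≠ (A * K + 2 * σ) * ((A + 1) * K + 2 * σ) *
      (A * (A + 1) * K + 2 * σ * (2 * A + 1)))
    (hA : 2 ≤ A) (hK : 23000 ≤ K) : ¬240 * (A + 1) ≤ K := by
  intro hKA
  obtain ⟨ha, hb, hc, hd, -, -, -, -, -, -, -, -, had, -, hbd, hcd⟩ := h
  obtain ⟨X, hX, h1⟩ := exists_pos_sq_eq had (by positivity)
  obtain ⟨Y, hY, h2⟩ := exists_pos_sq_eq hbd (by positivity)
  obtain ⟨Z, hZ, h3⟩ := exists_pos_sq_eq hcd (by positivity)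
  exact false_of_pell hA hK hKA hσ hX hY hZ hd h1 h2 h3 hirr

theorem stmt_16 (ε A K d : ℤ) (hε : ε = -2 ∨ ε = 2) (hA : 0 < A) (hK : 0 < K)
    (h : IsDiophQuadruple 4 K (A ^ 2 * K + 2 * ε * A) ((A + 1) ^ 2 * K + 2 * ε * (A + 1)) d)
    (hd : 2 < d)
    (hirr : 4 * d ≠ (2 * A ^ 2 + 2 * A) ^ 2 * K ^ 3 + ε * (16 * A ^ 3 + 24 * A ^ 2 + 8 * A) * K ^ 2
      + (80 * A ^ 2 + 80 * A + 16) * K + ε * (32 * A + 16)) :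
    (A ≥ 1326 → (K : ℝ) < 240.24 * ((A : ℝ) + 1) + 0) ∧
    (A ≥ 454 → (K : ℝ) < 240.24 * ((A : ℝ) + 1) + 1000) ∧
    (A ≥ 3 → (K : ℝ) < 240.24 * ((A : ℝ) + 1) + 23000) ∧
    (A ≥ 2 → (K : ℝ) < 240.24 * ((A : ℝ) + 1) + 210000) := by
  obtain ⟨σ, rfl, hσ⟩ : ∃ σ, ε = 2 * σ ∧ (σ = 1 ∨ σ = -1) := by
    rcases hε with rfl | rfl
    · exact ⟨-1, rfl, Or.inr rfl⟩
    · exact ⟨1, rfl, Or.inl rfl⟩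
  have hσ2 : σ ^ 2 = 1 := by rcases hσ with rfl | rfl <;> norm_num
  have hirr' : d ≠ (A * K + 2 * σ) * ((A + 1) * K + 2 * σ) *
      (A * (A + 1) * K + 2 * σ * (2 * A + 1)) := by
    rintro rfl
    refine hirr ?_
    linear_combination (16 * σ * (2 * A + 1) * 2 + (80 * A ^ 2 + 80 * A + 16) * K) * hσ2
  have hlt : ∀ c : ℝ, 2 ≤ A → 23000 ≤ 240.24 * ((A : ℝ) + 1) + c → 0 ≤ c →
      (K : ℝ) < 240.24 * ((A : ℝ) + 1) + c := fun c hA2 hc hc0 => by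
    by_contra! hle
    refine not_le_of_isDiophQuadruple hσ (by convert h using 1 <;> ring) hirr' hA2 ?_ ?_
    · exact_mod_cast hc.trans hle
    · have hA0 : (0 : ℝ) < A := by exact_mod_cast hA
      exact_mod_cast (show (240 * (A + 1) : ℝ) ≤ K by linarith)
  refine ⟨fun h => ?_, fun h => ?_, fun h => ?_, fun h => ?_⟩ <;>
    have h' : ((_ : ℤ) : ℝ) ≤ A := Int.cast_le.2 h <;> push_cast at h' <;>
    exact hlt _ (by omega) (by linarith) (by norm_num)
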